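/- (Second half of Lemma 3.1) Let Ξ : V₊ → ℂ be smooth with □Ξ = 0 on V₊, let B ⊆ V₊ be compact, let ε > 0, and fix ν ∈ {0,1,2,3}. Then there exist finitely many multi-indices 𝛍 = (μ₁, …, μ_m) with μ_i ∈ {0,1,2,3} and m odd, and complex constants c'_𝛍, such that sup_{β ∈ B} | ∂_ν Ξ(β) − Σ_𝛍 c'_𝛍 ∂_ν ∂_{μ₁}⋯∂_{μ_m} (β·β)⁻¹ | < ε. -/

import Mathlib

noncomputable section

/-- Minkowski inner product on ℝ⁴: x·y = x₀y₀ − x₁y₁ − x₂y₂ − x₃y₃. -/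
def mink (x y : Fin 4 → ℝ) : ℝ := x 0 * y 0 - x 1 * y 1 - x 2 * y 2 - x 3 * y 3

/-- Partial derivative in the ν-th coordinate direction. -/
def pd {E : Type*} [NormedAddCommGroup E] [NormedSpace ℝ E]
    (ν : Fin 4) (f : (Fin 4 → ℝ) → E) (x : Fin 4 → ℝ) : E :=
  fderiv ℝ f x (Pi.single ν 1)

/-- Iterated partial derivative ∂_{μ₁}⋯∂_{μ_m} along a multi-index
𝛍 = (μ₁, …, μ_m). -/
def pdIter : List (Fin 4) → ((Fin 4 → ℝ) → ℝ) → ((Fin 4 → ℝ) → ℝ)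
  | [], f => f
  | ν :: μ, f => pd ν (pdIter μ f)

/-- The d'Alembertian □ = ∂₀² − ∂₁² − ∂₂² − ∂₃². -/
def box {E : Type*} [NormedAddCommGroup E] [NormedSpace ℝ E]
    (f : (Fin 4 → ℝ) → E) (x : Fin 4 → ℝ) : E :=
  pd 0 (pd 0 f) x - pd 1 (pd 1 f) x - pd 2 (pd 2 f) x - pd 3 (pd 3 f) x

/-- The open forward light cone V₊ = {x : x₀ > 0, x·x > 0}. -/
def Vplus : Set (Fin 4 → ℝ) := {x | 0 < x 0 ∧ 0 < mink x x}

section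

open Set Filter Topology MeasureTheory

/-! ### Calculus of partial derivatives -/

section PartialDerivatives

variable {E : Type*} [NormedAddCommGroup E] [NormedSpace ℝ E]

lemma Filter.EventuallyEq.pd_eventuallyEq {f g : (Fin 4 → ℝ) → E} {x : Fin 4 → ℝ}
    (h : f =ᶠ[𝓝 x] g) (i : Fin 4) : pd i f =ᶠ[𝓝 x] pd i g := by
  filter_upwards [h.fderiv (𝕜 := ℝ)] with y hy
  simp [pd, hy]

lemma Filter.EventuallyEq.pd_eq {f g : (Fin 4 → ℝ) → E} {x : Fin 4 → ℝ}
    (h : f =ᶠ[𝓝 x] g) (i : Fin 4) : pd i f x = pd i g x :=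
  (h.pd_eventuallyEq i).self_of_nhds

lemma Filter.EventuallyEq.box_eq {f g : (Fin 4 → ℝ) → E} {x : Fin 4 → ℝ}
    (h : f =ᶠ[𝓝 x] g) : box f x = box g x := by
  simp only [box, fun i => (h.pd_eventuallyEq i).pd_eq i]

lemma pd_const (c : E) (i : Fin 4) : pd i (fun _ : Fin 4 → ℝ => c) = fun _ => 0 := by
  funext x; simp [pd]

lemma box_const (c : E) (x : Fin 4 → ℝ) : box (fun _ : Fin 4 → ℝ => c) x = 0 := by
  simp [box, pd_const]

lemma ContDiffAt.pd_smooth {f : (Fin 4 → ℝ) → E} {x : Fin 4 → ℝ}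
    (hf : ContDiffAt ℝ (⊤ : ℕ∞) f x) (i : Fin 4) : ContDiffAt ℝ (⊤ : ℕ∞) (pd i f) x := by
  have h : ContDiffAt ℝ (⊤ : ℕ∞) (fderiv ℝ f) x := hf.fderiv_right (by norm_cast)
  exact h.clm_apply contDiffAt_const

lemma ContDiff.pd_smooth {f : (Fin 4 → ℝ) → E}
    (hf : ContDiff ℝ (⊤ : ℕ∞) f) (i : Fin 4) : ContDiff ℝ (⊤ : ℕ∞) (pd i f) :=
  contDiff_iff_contDiffAt.2 fun _ => hf.contDiffAt.pd_smooth i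

lemma ContDiff.box_smooth {f : (Fin 4 → ℝ) → E}
    (hf : ContDiff ℝ (⊤ : ℕ∞) f) : ContDiff ℝ (⊤ : ℕ∞) (box f) :=
  ((((hf.pd_smooth 0).pd_smooth 0).sub ((hf.pd_smooth 1).pd_smooth 1)).sub
    ((hf.pd_smooth 2).pd_smooth 2)).sub ((hf.pd_smooth 3).pd_smooth 3)

lemma ContDiffAt.differentiableAt_smooth {f : (Fin 4 → ℝ) → E} {x : Fin 4 → ℝ}
    (hf : ContDiffAt ℝ (⊤ : ℕ∞) f x) : DifferentiableAt ℝ f x :=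
  hf.differentiableAt (by simp)

lemma pd_comm {f : (Fin 4 → ℝ) → E} {x : Fin 4 → ℝ}
    (hf : ContDiffAt ℝ (⊤ : ℕ∞) f x) (i j : Fin 4) : pd i (pd j f) x = pd j (pd i f) x := by
  have hd : DifferentiableAt ℝ (fderiv ℝ f) x :=
    (hf.fderiv_right (m := (⊤ : ℕ∞)) (by norm_cast)).differentiableAt (by simp)
  have key (k l : Fin 4) :
      pd k (pd l f) x = fderiv ℝ (fderiv ℝ f) x (Pi.single k 1) (Pi.single l 1) := by
    have := (hd.hasFDerivAt.clm_apply (hasFDerivAt_const (Pi.single l (1 : ℝ)) x)).fderiv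
    have h2 : pd k (pd l f) x
        = fderiv ℝ (fun y => fderiv ℝ f y (Pi.single l 1)) x (Pi.single k 1) := rfl
    rw [h2, this]; simp
  rw [key, key]
  exact ((hf.of_le (WithTop.coe_le_coe.2 le_top : ((2 : ℕ∞) : WithTop ℕ∞) ≤ _)).isSymmSndFDerivAt
    (by simp)).eq _ _

lemma pd_sub {f g : (Fin 4 → ℝ) → E} {x : Fin 4 → ℝ} (hf : DifferentiableAt ℝ f x)
    (hg : DifferentiableAt ℝ g x) (i : Fin 4) :
    pd i (fun y => f y - g y) x = pd i f x - pd i g x := by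
  simp [pd, fderiv_fun_sub hf hg]

lemma pd_mul {f g : (Fin 4 → ℝ) → ℂ} {x : Fin 4 → ℝ} (hf : DifferentiableAt ℝ f x)
    (hg : DifferentiableAt ℝ g x) (i : Fin 4) :
    pd i (fun y => f y * g y) x = pd i f x * g x + f x * pd i g x := by
  simp [pd, fderiv_fun_mul hf hg]; ring

lemma pd_const_mul {f : (Fin 4 → ℝ) → ℂ} {x : Fin 4 → ℝ} (hf : DifferentiableAt ℝ f x)
    (c : ℂ) (i : Fin 4) : pd i (fun y => c * f y) x = c * pd i f x := by
  rw [pd_mul (differentiableAt_const c) hf, pd_const]; simp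

lemma pd_inv {f : (Fin 4 → ℝ) → ℂ} {x : Fin 4 → ℝ} (hf : DifferentiableAt ℝ f x)
    (h0 : f x ≠ 0) (i : Fin 4) :
    pd i (fun y => (f y)⁻¹) x = - pd i f x * ((f x)⁻¹) ^ 2 := by
  have h := ((hasFDerivAt_inv' (𝕜 := ℝ) h0).comp x hf.hasFDerivAt).fderiv
  have h2 : pd i (fun y => (f y)⁻¹) x = fderiv ℝ (Inv.inv ∘ f) x (Pi.single i 1) := rfl
  rw [h2, h]
  simp [pd]
  ring

lemma pd_const_sub_comp {f : (Fin 4 → ℝ) → E} (hf : ContDiff ℝ (⊤ : ℕ∞) f) (b : Fin 4 → ℝ)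
    (i : Fin 4) : pd i (fun y => f (b - y)) = fun y => - pd i f (b - y) := by
  funext y
  have h := (hf.contDiffAt (x := b - y)).differentiableAt_smooth.hasFDerivAt.comp y
    ((hasFDerivAt_id (𝕜 := ℝ) y).const_sub b)
  rw [show pd i (fun y => f (b - y)) y = _ from DFunLike.congr_fun h.fderiv (Pi.single i 1)]
  simp [pd]

lemma box_const_sub_comp {f : (Fin 4 → ℝ) → E} (hf : ContDiff ℝ (⊤ : ℕ∞) f)
    (b x : Fin 4 → ℝ) :
    box (fun y => f (b - y)) x = box f (b - x) := by
  have h (i : Fin 4) : pd i (pd i (fun y => f (b - y))) x = pd i (pd i f) (b - x) := by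
    rw [pd_const_sub_comp hf]
    have : pd i (fun y => -pd i f (b - y)) x = - pd i (fun y => pd i f (b - y)) x := by
      simp [pd]
    rw [this, pd_const_sub_comp (hf.pd_smooth i)]; simp
  simp only [box, h]

lemma box_pd {f : (Fin 4 → ℝ) → E} (hf : ContDiff ℝ (⊤ : ℕ∞) f) (i : Fin 4) (x : Fin 4 → ℝ) :
    box (pd i f) x = pd i (box f) x := by
  have h1 (j : Fin 4) : pd j (pd j (pd i f)) x = pd i (pd j (pd j f)) x := by
    have : pd j (pd i f) = pd i (pd j f) := funext fun y => pd_comm hf.contDiffAt _ _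
    rw [this]
    exact pd_comm (hf.pd_smooth j).contDiffAt _ _
  have hd (j : Fin 4) : DifferentiableAt ℝ (pd j (pd j f)) x :=
    ((hf.pd_smooth j).pd_smooth j).contDiffAt.differentiableAt_smooth
  have h2 : pd i (box f) x = pd i (pd 0 (pd 0 f)) x - pd i (pd 1 (pd 1 f)) x
      - pd i (pd 2 (pd 2 f)) x - pd i (pd 3 (pd 3 f)) x := by
    rw [← pd_sub (hd 0) (hd 1), ← pd_sub ((hd 0).fun_sub (hd 1)) (hd 2),
      ← pd_sub (((hd 0).fun_sub (hd 1)).fun_sub (hd 2)) (hd 3)]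
    rfl
  rw [h2]
  simp only [box, h1]

end PartialDerivatives

/-! ### The complexified kernel -/

/-- The diagonal entries of the Minkowski metric. -/
def metricSign : Fin 4 → ℝ := ![1, -1, -1, -1]

/-- The complex-bilinear extension of the Minkowski square. -/
def minkSqC (w : Fin 4 → ℂ) : ℂ := w 0 ^ 2 - w 1 ^ 2 - w 2 ^ 2 - w 3 ^ 2

/-- The real point `x` moved by `-iη` in the time direction. -/
def timeShift (η : ℝ) (x : Fin 4 → ℝ) : Fin 4 → ℂ :=
  fun i => (x i : ℂ) - (if i = 0 then (η : ℂ) * Complex.I else 0)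

/-- The `ν`-th partial derivative of the inverse Minkowski square on `ℂ⁴`. -/
def gradInvSq (ν : Fin 4) (w : Fin 4 → ℂ) : ℂ :=
  -2 * (metricSign ν : ℂ) * w ν * ((minkSqC w)⁻¹) ^ 2

lemma minkSqC_timeShift_ne_zero {η : ℝ} {x : Fin 4 → ℝ} (h : mink x x ≠ 0 ∨ η ≠ 0) :
    minkSqC (timeShift η x) ≠ 0 := by
  intro h0
  have hre := congrArg Complex.re h0
  have him := congrArg Complex.im h0
  simp [minkSqC, timeShift, pow_two] at hre him
  rcases eq_or_ne η 0 with hη | hη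
  · subst hη
    rcases h with h | h
    · apply h; simp [mink]; linarith
    · exact h rfl
  · have hx0 : x 0 = 0 := by
      have : η * x 0 = 0 := by linarith
      exact (mul_eq_zero.1 this).resolve_left hη
    rw [hx0] at hre
    have := sq_pos_of_ne_zero hη
    nlinarith [sq_nonneg (x 1), sq_nonneg (x 2), sq_nonneg (x 3)]

lemma contDiff_timeShift (η : ℝ) (i : Fin 4) :
    ContDiff ℝ (⊤ : ℕ∞) (fun x => timeShift η x i) := by
  unfold timeShift
  have h : ContDiff ℝ (⊤ : ℕ∞) (fun x : Fin 4 → ℝ => ((x i : ℝ) : ℂ)) :=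
    Complex.ofRealCLM.contDiff.comp (contDiff_apply ℝ ℝ i)
  exact h.sub contDiff_const

lemma contDiff_minkSqC_timeShift (η : ℝ) :
    ContDiff ℝ (⊤ : ℕ∞) (fun x => minkSqC (timeShift η x)) := by
  unfold minkSqC
  have h := contDiff_timeShift η
  exact ((((h 0).pow 2).sub ((h 1).pow 2)).sub ((h 2).pow 2)).sub ((h 3).pow 2)

lemma pd_timeShift (η : ℝ) (i j : Fin 4) (x : Fin 4 → ℝ) :
    pd i (fun y => timeShift η y j) x = if i = j then 1 else 0 := by
  have h : HasFDerivAt (fun y : Fin 4 → ℝ => timeShift η y j)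
      (Complex.ofRealCLM.comp (ContinuousLinearMap.proj (R := ℝ) (φ := fun _ : Fin 4 => ℝ) j)) x :=
    ((Complex.ofRealCLM.comp
      (ContinuousLinearMap.proj (R := ℝ) (φ := fun _ : Fin 4 => ℝ) j)).hasFDerivAt).sub_const _
  simp only [pd, h.fderiv]
  by_cases hij : i = j
  · subst hij; simp
  · simp [hij]

lemma pd_minkSqC_timeShift (η : ℝ) (i : Fin 4) (x : Fin 4 → ℝ) :
    pd i (fun y => minkSqC (timeShift η y)) x = 2 * (metricSign i : ℂ) * timeShift η x i := by
  have hd (j : Fin 4) : DifferentiableAt ℝ (fun y => timeShift η y j) x :=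
    (contDiff_timeShift η j).contDiffAt.differentiableAt_smooth
  have hsq (j : Fin 4) : pd i (fun y => timeShift η y j ^ 2) x
      = if i = j then 2 * timeShift η x j else 0 := by
    simp only [pow_two]
    rw [pd_mul (hd j) (hd j), pd_timeShift]
    split_ifs <;> ring
  have h2 (j : Fin 4) : DifferentiableAt ℝ (fun y => timeShift η y j ^ 2) x := (hd j).pow 2
  unfold minkSqC
  rw [pd_sub (((h2 0).fun_sub (h2 1)).fun_sub (h2 2)) (h2 3), pd_sub ((h2 0).fun_sub (h2 1)) (h2 2),
    pd_sub (h2 0) (h2 1), hsq, hsq, hsq, hsq]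
  fin_cases i <;> simp [metricSign]

lemma pd_inv_minkSqC_timeShift {η : ℝ} {x : Fin 4 → ℝ} (h : mink x x ≠ 0 ∨ η ≠ 0) (i : Fin 4) :
    pd i (fun y => (minkSqC (timeShift η y))⁻¹) x = gradInvSq i (timeShift η x) := by
  rw [pd_inv (contDiff_minkSqC_timeShift η).contDiffAt.differentiableAt_smooth
    (minkSqC_timeShift_ne_zero h), pd_minkSqC_timeShift, gradInvSq]
  ring

lemma contDiff_inv_minkSqC_timeShift {η : ℝ} (hη : η ≠ 0) :
    ContDiff ℝ (⊤ : ℕ∞) (fun x => (minkSqC (timeShift η x))⁻¹) :=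
  (contDiff_minkSqC_timeShift η).inv fun _ => minkSqC_timeShift_ne_zero (Or.inr hη)

lemma box_inv_minkSqC_timeShift {η : ℝ} (hη : η ≠ 0) (x : Fin 4 → ℝ) :
    box (fun y => (minkSqC (timeShift η y))⁻¹) x = 0 := by
  have h0 : minkSqC (timeShift η x) ≠ 0 := minkSqC_timeShift_ne_zero (Or.inr hη)
  have hinv : DifferentiableAt ℝ (fun y => (minkSqC (timeShift η y))⁻¹) x :=
    (contDiff_inv_minkSqC_timeShift hη).contDiffAt.differentiableAt_smooth
  have hd (j : Fin 4) : DifferentiableAt ℝ (fun y => timeShift η y j) x :=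
    (contDiff_timeShift η j).contDiffAt.differentiableAt_smooth
  have h2 (i : Fin 4) : pd i (pd i (fun y => (minkSqC (timeShift η y))⁻¹)) x
      = -2 * (metricSign i : ℂ) * ((minkSqC (timeShift η x))⁻¹) ^ 2
        + 8 * (metricSign i : ℂ) ^ 2 * timeShift η x i ^ 2
          * ((minkSqC (timeShift η x))⁻¹) ^ 3 := by
    have h1 : pd i (fun y => (minkSqC (timeShift η y))⁻¹)
        = fun y => (-2 * (metricSign i : ℂ)) * (timeShift η y i *
          ((minkSqC (timeShift η y))⁻¹ * (minkSqC (timeShift η y))⁻¹)) := by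
      funext y
      rw [pd_inv_minkSqC_timeShift (Or.inr hη), gradInvSq]; ring
    rw [h1, pd_const_mul ((hd i).fun_mul (hinv.fun_mul hinv)), pd_mul (hd i) (hinv.fun_mul hinv),
      pd_mul hinv hinv, pd_timeShift, pd_inv_minkSqC_timeShift (Or.inr hη), gradInvSq]
    simp only [if_true]
    ring
  simp only [box, h2]
  have e0 : (metricSign 0 : ℂ) = 1 := by simp [metricSign]
  have e1 : (metricSign 1 : ℂ) = -1 := by simp [metricSign]
  have e2 : (metricSign 2 : ℂ) = -1 := by simp [metricSign]
  have e3 : (metricSign 3 : ℂ) = -1 := by simp [metricSign]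
  rw [e0, e1, e2, e3]
  field_simp
  unfold minkSqC
  ring

/-- The difference of boundary-value approximants of the inverse Minkowski square. -/
def commKernel (η : ℝ) (x : Fin 4 → ℝ) : ℂ :=
  (minkSqC (timeShift η x))⁻¹ - (minkSqC (timeShift (-η) x))⁻¹

lemma contDiff_commKernel {η : ℝ} (hη : η ≠ 0) : ContDiff ℝ (⊤ : ℕ∞) (commKernel η) :=
  (contDiff_inv_minkSqC_timeShift hη).sub (contDiff_inv_minkSqC_timeShift (neg_ne_zero.2 hη))

lemma pd_commKernel {η : ℝ} (hη : η ≠ 0) (i : Fin 4) (x : Fin 4 → ℝ) :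
    pd i (commKernel η) x = gradInvSq i (timeShift η x) - gradInvSq i (timeShift (-η) x) := by
  unfold commKernel
  rw [pd_sub (contDiff_inv_minkSqC_timeShift hη).contDiffAt.differentiableAt_smooth
    (contDiff_inv_minkSqC_timeShift (neg_ne_zero.2 hη)).contDiffAt.differentiableAt_smooth,
    pd_inv_minkSqC_timeShift (Or.inr hη), pd_inv_minkSqC_timeShift (Or.inr (neg_ne_zero.2 hη))]

lemma box_commKernel {η : ℝ} (hη : η ≠ 0) (x : Fin 4 → ℝ) : box (commKernel η) x = 0 := by
  have h1 := contDiff_inv_minkSqC_timeShift hη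
  have h2 := contDiff_inv_minkSqC_timeShift (neg_ne_zero.2 hη)
  have h (i : Fin 4) : pd i (pd i (commKernel η)) x
      = pd i (pd i fun y => (minkSqC (timeShift η y))⁻¹) x
        - pd i (pd i fun y => (minkSqC (timeShift (-η) y))⁻¹) x := by
    have : pd i (commKernel η) = fun x => pd i (fun y => (minkSqC (timeShift η y))⁻¹) x
        - pd i (fun y => (minkSqC (timeShift (-η) y))⁻¹) x := by
      funext x
      unfold commKernel
      exact pd_sub h1.contDiffAt.differentiableAt_smooth h2.contDiffAt.differentiableAt_smooth i
    rw [this]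
    exact pd_sub (h1.pd_smooth i).contDiffAt.differentiableAt_smooth
      (h2.pd_smooth i).contDiffAt.differentiableAt_smooth i
  have b1 := box_inv_minkSqC_timeShift hη x
  have b2 := box_inv_minkSqC_timeShift (neg_ne_zero.2 hη) x
  simp only [box] at b1 b2 ⊢
  rw [h, h, h, h]
  linear_combination b1 - b2

lemma commKernel_of_time_zero {η : ℝ} {x : Fin 4 → ℝ} (hx : x 0 = 0) : commKernel η x = 0 := by
  have : minkSqC (timeShift (-η) x) = minkSqC (timeShift η x) := by
    simp [minkSqC, timeShift, hx]
  simp [commKernel, this]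

lemma pd_zero_commKernel_of_time_zero {η : ℝ} (hη : η ≠ 0) {x : Fin 4 → ℝ} (hx : x 0 = 0) :
    pd 0 (commKernel η) x
      = 4 * Complex.I * ((η / (η ^ 2 + (x 1 ^ 2 + x 2 ^ 2 + x 3 ^ 2)) ^ 2 : ℝ) : ℂ) := by
  have hs (s : ℝ) (hs : s ^ 2 = η ^ 2) : minkSqC (timeShift s x)
      = -((η ^ 2 + (x 1 ^ 2 + x 2 ^ 2 + x 3 ^ 2) : ℝ) : ℂ) := by
    rw [← hs]
    simp [minkSqC, timeShift, hx]
    ring_nf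
    simp
  have e0 : (metricSign 0 : ℂ) = 1 := by simp [metricSign]
  rw [pd_commKernel hη, gradInvSq, gradInvSq, hs η rfl, hs (-η) (by ring), e0]
  simp [timeShift, hx]
  ring

/-! ### Green's identity on a box -/

lemma pd_eq_zero_of_notMem_tsupport {u : (Fin 4 → ℝ) → ℂ} {x : Fin 4 → ℝ}
    (hx : x ∉ tsupport u) (i : Fin 4) : pd i u x = 0 := by
  have h : u =ᶠ[𝓝 x] fun _ => 0 := notMem_tsupport_iff_eventuallyEq.1 hx
  rw [h.pd_eq, pd_const]

lemma box_eq_zero_of_notMem_tsupport {u : (Fin 4 → ℝ) → ℂ} {x : Fin 4 → ℝ}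
    (hx : x ∉ tsupport u) : box u x = 0 := by
  have h : u =ᶠ[𝓝 x] fun _ => 0 := notMem_tsupport_iff_eventuallyEq.1 hx
  rw [h.box_eq, box_const]

lemma tsupport_pd_subset (u : (Fin 4 → ℝ) → ℂ) (i : Fin 4) : tsupport (pd i u) ⊆ tsupport u :=
  closure_minimal (fun _ hx => by_contra fun h => hx (pd_eq_zero_of_notMem_tsupport h i))
    (isClosed_tsupport u)

/-- The lower corner of the space-time box of spatial half-width `R`. -/
def lowerCorner (R : ℝ) : Fin 4 → ℝ := Fin.cons 0 fun _ => -R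

/-- The upper corner of the space-time box of spatial half-width `R` and final time `t`. -/
def upperCorner (t R : ℝ) : Fin 4 → ℝ := Fin.cons t fun _ => R

/-- The flux whose divergence is `-∂_ν k · □u` when `□k = 0`. -/
def greenFlux (k u : (Fin 4 → ℝ) → ℂ) (ν i : Fin 4) (x : Fin 4 → ℝ) : ℂ :=
  (metricSign i : ℂ) * (k x * pd i (pd ν u) x - pd ν u x * pd i k x)
    - (if i = ν then 1 else 0) * (k x * box u x)

lemma contDiff_greenFlux {k u : (Fin 4 → ℝ) → ℂ} (hk : ContDiff ℝ (⊤ : ℕ∞) k)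
    (hu : ContDiff ℝ (⊤ : ℕ∞) u) (ν i : Fin 4) : ContDiff ℝ (⊤ : ℕ∞) (greenFlux k u ν i) := by
  have hv := hu.pd_smooth ν
  exact (contDiff_const.mul ((hk.mul (hv.pd_smooth i)).sub (hv.mul (hk.pd_smooth i)))).sub
    (contDiff_const.mul (hk.mul hu.box_smooth))

lemma sum_pd_greenFlux {k u : (Fin 4 → ℝ) → ℂ} (hk : ContDiff ℝ (⊤ : ℕ∞) k)
    (hu : ContDiff ℝ (⊤ : ℕ∞) u) (hbox : ∀ x, box k x = 0) (ν : Fin 4) (x : Fin 4 → ℝ) :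
    ∑ i, pd i (greenFlux k u ν i) x = - pd ν k x * box u x := by
  have hv := hu.pd_smooth ν
  have D {f : (Fin 4 → ℝ) → ℂ} (hf : ContDiff ℝ (⊤ : ℕ∞) f) : DifferentiableAt ℝ f x :=
    hf.contDiffAt.differentiableAt_smooth
  have h (i : Fin 4) : pd i (greenFlux k u ν i) x
      = (metricSign i : ℂ) * (k x * pd i (pd i (pd ν u)) x - pd ν u x * pd i (pd i k) x)
        - (if i = ν then 1 else 0) * (pd i k x * box u x + k x * pd i (box u) x) := by
    unfold greenFlux
    have e1 : ContDiff ℝ (⊤ : ℕ∞) fun x => k x * pd i (pd ν u) x := hk.mul (hv.pd_smooth i)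
    have e2 : ContDiff ℝ (⊤ : ℕ∞) fun x => pd ν u x * pd i k x := hv.mul (hk.pd_smooth i)
    have e3 : ContDiff ℝ (⊤ : ℕ∞) fun x => k x * box u x := hk.mul hu.box_smooth
    rw [pd_sub (D (contDiff_const.mul (e1.sub e2))) (D (contDiff_const.mul e3)),
      pd_const_mul (D (e1.sub e2)), pd_const_mul (D e3), pd_sub (D e1) (D e2),
      pd_mul (D hk) (D (hv.pd_smooth i)), pd_mul (D hv) (D (hk.pd_smooth i)),
      pd_mul (D hk) (D hu.box_smooth)]
    ring
  have hb := box_pd hu ν x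
  have hk0 := hbox x
  simp only [h, Finset.sum_sub_distrib, ite_mul, one_mul, zero_mul, Finset.sum_ite_eq',
    Finset.mem_univ, if_true]
  rw [← hb]
  simp only [box] at hk0 ⊢
  simp only [Fin.sum_univ_four, metricSign]
  simp
  linear_combination -(pd ν u x) * hk0

lemma integral_pd_mul_box_eq_face {k u : (Fin 4 → ℝ) → ℂ} (hk : ContDiff ℝ (⊤ : ℕ∞) k)
    (hu : ContDiff ℝ (⊤ : ℕ∞) u) (hbox : ∀ x, box k x = 0) {t R : ℝ} (ht : 0 ≤ t) (hR : 0 ≤ R)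
    (hsupp : tsupport u ⊆ {x | 0 < x 0 ∧ ∀ i : Fin 3, |x i.succ| < R})
    (hkt : ∀ x, x 0 = t → k x = 0) (ν : Fin 4) :
    ∫ x in Icc (lowerCorner R) (upperCorner t R), -pd ν k x * box u x
      = ∫ y in Icc (fun _ : Fin 3 => -R) (fun _ => R),
          -pd ν u (Fin.cons t y) * pd 0 k (Fin.cons t y) := by
  have hle : lowerCorner R ≤ upperCorner t R := by
    intro i
    refine Fin.cases ?_ (fun j => ?_) i <;> simp [lowerCorner, upperCorner] <;> linarith
  have hF := contDiff_greenFlux hk hu ν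
  have hzero (i : Fin 4) (x : Fin 4 → ℝ) (hx : x ∉ tsupport u) : greenFlux k u ν i x = 0 := by
    have hx' : x ∉ tsupport (pd ν u) := fun h => hx (tsupport_pd_subset u ν h)
    simp [greenFlux, pd_eq_zero_of_notMem_tsupport hx, pd_eq_zero_of_notMem_tsupport hx',
      box_eq_zero_of_notMem_tsupport hx]
  have hdiv := integral_divergence_of_hasFDerivAt_off_countable' (lowerCorner R) (upperCorner t R)
    hle (fun i => greenFlux k u ν i) (fun i x => fderiv ℝ (greenFlux k u ν i) x) ∅ countable_empty
    (fun i => (hF i).continuous.continuousOn)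
    (fun x _ i => ((hF i).contDiffAt.differentiableAt_smooth).hasFDerivAt)
    (by
      refine Continuous.integrableOn_Icc ?_
      exact continuous_finsetSum _ fun i _ => ((hF i).pd_smooth i).continuous)
  have hL : (fun x => ∑ i, fderiv ℝ (greenFlux k u ν i) x (Pi.single i 1))
      = fun x => -pd ν k x * box u x := by
    funext x
    rw [← sum_pd_greenFlux hk hu hbox ν x]
    rfl
  rw [hL] at hdiv
  rw [hdiv, Fin.sum_univ_succ]
  have hside : ∀ i : Fin 3, ∀ s : ℝ, |s| = R → ∀ y : Fin 3 → ℝ,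
      greenFlux k u ν i.succ (i.succ.insertNth s y : Fin 4 → ℝ) = 0 := by
    intro i s hs y
    refine hzero _ _ fun hmem => ?_
    have := (hsupp hmem).2 i
    rw [Fin.insertNth_apply_same, hs] at this
    exact lt_irrefl _ this
  have hsum : ∑ i : Fin 3,
      ((∫ y in Icc (lowerCorner R ∘ i.succ.succAbove) (upperCorner t R ∘ i.succ.succAbove),
          greenFlux k u ν i.succ (i.succ.insertNth (upperCorner t R i.succ) y))
        - ∫ y in Icc (lowerCorner R ∘ i.succ.succAbove) (upperCorner t R ∘ i.succ.succAbove),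
          greenFlux k u ν i.succ (i.succ.insertNth (lowerCorner R i.succ) y)) = 0 := by
    refine Finset.sum_eq_zero fun i _ => ?_
    have h1 : upperCorner t R i.succ = R := by simp [upperCorner]
    have h2 : lowerCorner R i.succ = -R := by simp [lowerCorner]
    rw [h1, h2]
    simp only [hside i R (abs_of_nonneg hR), hside i (-R) (by rw [abs_neg, abs_of_nonneg hR])]
    simp
  rw [hsum, add_zero]
  have hbot : ∀ y : Fin 3 → ℝ,
      greenFlux k u ν 0 ((0 : Fin 4).insertNth (lowerCorner R 0) y : Fin 4 → ℝ) = 0 := by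
    intro y
    refine hzero _ _ fun hmem => ?_
    have := (hsupp hmem).1
    rw [Fin.insertNth_apply_same] at this
    simp [lowerCorner] at this
  simp only [hbot, integral_zero, sub_zero]
  have hlo : lowerCorner R ∘ (0 : Fin 4).succAbove = fun _ : Fin 3 => -R := by
    funext i; simp [lowerCorner]
  have hhi : upperCorner t R ∘ (0 : Fin 4).succAbove = fun _ : Fin 3 => R := by
    funext i; simp [upperCorner]
  rw [hlo, hhi]
  refine integral_congr_ae (Eventually.of_forall fun y => ?_)
  have htop : ((0 : Fin 4).insertNth (upperCorner t R 0) y : Fin 4 → ℝ) = Fin.cons t y := by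
    simp [upperCorner]
  have hk0 : k (Fin.cons t y) = 0 := hkt _ (by simp)
  simp only [htop, greenFlux, hk0]
  simp [metricSign]

/-! ### An approximate identity on `ℝ³` -/

/-- The profile `(1 + |s|²)⁻²` on `ℝ³`. -/
def profile (s : Fin 3 → ℝ) : ℝ := ((1 + (s 0 ^ 2 + s 1 ^ 2 + s 2 ^ 2)) ^ 2)⁻¹

lemma continuous_profile : Continuous profile := by
  unfold profile
  refine Continuous.inv₀ (by fun_prop) fun s => ?_
  positivity

lemma profile_pos (s : Fin 3 → ℝ) : 0 < profile s := by unfold profile; positivity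

lemma profile_le (s : Fin 3 → ℝ) : profile s ≤ 4 * (1 + ‖s‖) ^ (-4 : ℝ) := by
  have hs : ‖s‖ ^ 2 ≤ s 0 ^ 2 + s 1 ^ 2 + s 2 ^ 2 := by
    have h : ‖s‖ ≤ Real.sqrt (s 0 ^ 2 + s 1 ^ 2 + s 2 ^ 2) := by
      rw [pi_norm_le_iff_of_nonneg (Real.sqrt_nonneg _)]
      intro i
      apply Real.le_sqrt_of_sq_le
      rw [Real.norm_eq_abs, sq_abs]
      fin_cases i <;> simp <;> nlinarith [sq_nonneg (s 0), sq_nonneg (s 1), sq_nonneg (s 2)]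
    calc ‖s‖ ^ 2 ≤ Real.sqrt (s 0 ^ 2 + s 1 ^ 2 + s 2 ^ 2) ^ 2 := by gcongr
      _ = _ := Real.sq_sqrt (by positivity)
  have hn := norm_nonneg s
  have h2 : (1 + ‖s‖) ^ 2 ≤ 2 * (1 + (s 0 ^ 2 + s 1 ^ 2 + s 2 ^ 2)) := by
    nlinarith [sq_nonneg (1 - ‖s‖)]
  have h4 : (1 + ‖s‖) ^ 4 ≤ 4 * (1 + (s 0 ^ 2 + s 1 ^ 2 + s 2 ^ 2)) ^ 2 := by
    calc (1 + ‖s‖) ^ 4 = ((1 + ‖s‖) ^ 2) ^ 2 := by ring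
      _ ≤ (2 * (1 + (s 0 ^ 2 + s 1 ^ 2 + s 2 ^ 2))) ^ 2 := by gcongr
      _ = _ := by ring
  have hr : (1 + ‖s‖) ^ (-4 : ℝ) = ((1 + ‖s‖) ^ 4)⁻¹ := by
    rw [Real.rpow_neg (by positivity)]
    norm_cast
  rw [hr, profile, ← div_eq_mul_inv, le_div_iff₀ (by positivity), inv_mul_le_iff₀ (by positivity)]
  linarith

lemma integrable_profile : Integrable profile := by
  have h := (integrable_one_add_norm (E := Fin 3 → ℝ) (μ := volume) (r := 4)
    (by simp; norm_num)).const_mul 4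
  refine h.mono' continuous_profile.aestronglyMeasurable (Eventually.of_forall fun s => ?_)
  rw [Real.norm_of_nonneg (profile_pos s).le]
  exact profile_le s

lemma integral_profile_pos : 0 < ∫ s, profile s := by
  refine (integral_pos_iff_support_of_nonneg (fun s => (profile_pos s).le)
    integrable_profile).2 ?_
  have : Function.support profile = univ := eq_univ_of_forall fun s => (profile_pos s).ne'
  rw [this]
  simp

/-- The rescaled profile `η (η² + |x|²)⁻²`. -/
def poissonProfile (η : ℝ) (x : Fin 3 → ℝ) : ℝ := η / (η ^ 2 + (x 0 ^ 2 + x 1 ^ 2 + x 2 ^ 2)) ^ 2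

lemma poissonProfile_smul {η : ℝ} (hη : 0 < η) (s : Fin 3 → ℝ) :
    poissonProfile η (η • s) = (η ^ 3)⁻¹ * profile s := by
  have h : (1 + (s 0 ^ 2 + s 1 ^ 2 + s 2 ^ 2)) ≠ 0 := by positivity
  have e : η ^ 2 + ((η * s 0) ^ 2 + (η * s 1) ^ 2 + (η * s 2) ^ 2)
      = η ^ 2 * (1 + (s 0 ^ 2 + s 1 ^ 2 + s 2 ^ 2)) := by ring
  simp only [poissonProfile, profile, Pi.smul_apply, smul_eq_mul, e]
  field_simp

lemma integral_mul_poissonProfile (g : (Fin 3 → ℝ) → ℂ) (b : Fin 3 → ℝ) {η : ℝ} (hη : 0 < η) :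
    ∫ y, g y * (poissonProfile η (b - y) : ℂ) = ∫ s, g (b - η • s) * (profile s : ℂ) := by
  have h1 : ∫ y, g y * (poissonProfile η (b - y) : ℂ)
      = ∫ y, g (b - y) * (poissonProfile η y : ℂ) := by
    rw [← integral_sub_left_eq_self (fun y => g y * (poissonProfile η (b - y) : ℂ)) volume b]
    simp
  have h2 := Measure.integral_comp_smul_of_nonneg (volume : Measure (Fin 3 → ℝ))
    (fun y => g (b - y) * (poissonProfile η y : ℂ)) η (hR := hη.le)
  rw [h1]
  have h3 : ∫ y, g (b - y) * (poissonProfile η y : ℂ)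
      = (η ^ 3 : ℝ) • ∫ s, g (b - η • s) * (poissonProfile η (η • s) : ℂ) := by
    rw [h2, smul_smul]
    simp [hη.ne']
  rw [h3, ← integral_smul]
  refine integral_congr_ae (Eventually.of_forall fun s => ?_)
  have : (η : ℂ) ≠ 0 := by exact_mod_cast hη.ne'
  simp only [poissonProfile_smul hη, Complex.real_smul]
  push_cast
  field_simp

lemma norm_integral_mul_poissonProfile_sub_le {g : (Fin 3 → ℝ) → ℂ} {M : ℝ} (hM : 0 ≤ M)
    (hg : Continuous g) (hh : ∀ x y, ‖g x - g y‖ ≤ M * Real.sqrt ‖x - y‖) (b : Fin 3 → ℝ) {η : ℝ}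
    (hη : 0 < η) :
    ‖(∫ y, g y * (poissonProfile η (b - y) : ℂ)) - ((∫ s, profile s : ℝ) : ℂ) * g b‖
      ≤ (M * ∫ s : Fin 3 → ℝ, 4 * (1 + ‖s‖) ^ (-(7 / 2) : ℝ)) * Real.sqrt η := by
  rw [integral_mul_poissonProfile g b hη]
  have hint : Integrable fun s : Fin 3 → ℝ => 4 * (1 + ‖s‖) ^ (-(7 / 2) : ℝ) :=
    (integrable_one_add_norm (E := Fin 3 → ℝ) (μ := volume) (r := 7 / 2)
      (by simp; norm_num)).const_mul 4
  have hbound (s : Fin 3 → ℝ) : ‖(g (b - η • s) - g b) * (profile s : ℂ)‖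
      ≤ (M * Real.sqrt η) * (4 * (1 + ‖s‖) ^ (-(7 / 2) : ℝ)) := by
    have h1 : ‖g (b - η • s) - g b‖ ≤ M * (Real.sqrt η * Real.sqrt (1 + ‖s‖)) := by
      refine (hh _ _).trans ?_
      rw [← Real.sqrt_mul hη.le]
      gcongr
      have : b - η • s - b = -(η • s) := by abel
      rw [this, norm_neg, norm_smul, Real.norm_of_nonneg hη.le]
      gcongr
      linarith
    have hn : 0 < 1 + ‖s‖ := by positivity
    have h2 : Real.sqrt (1 + ‖s‖) * (1 + ‖s‖) ^ (-4 : ℝ) = (1 + ‖s‖) ^ (-(7 / 2) : ℝ) := by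
      rw [Real.sqrt_eq_rpow, ← Real.rpow_add hn]
      norm_num
    rw [norm_mul, Complex.norm_real, Real.norm_of_nonneg (profile_pos s).le]
    calc ‖g (b - η • s) - g b‖ * profile s
        ≤ (M * (Real.sqrt η * Real.sqrt (1 + ‖s‖))) * (4 * (1 + ‖s‖) ^ (-4 : ℝ)) :=
          mul_le_mul h1 (profile_le s) (profile_pos s).le (by positivity)
      _ = (M * Real.sqrt η) * (4 * (Real.sqrt (1 + ‖s‖) * (1 + ‖s‖) ^ (-4 : ℝ))) := by ring
      _ = _ := by rw [h2]
  have hdiff : Integrable fun s => (g (b - η • s) - g b) * (profile s : ℂ) := by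
    refine (hint.const_mul (M * Real.sqrt η)).mono' ?_ (Eventually.of_forall hbound)
    refine Continuous.aestronglyMeasurable ?_
    have := continuous_profile
    fun_prop
  have hconst : Integrable fun s => g b * (profile s : ℂ) :=
    (integrable_profile.ofReal).const_mul (g b)
  have hsplit : ∫ s, g (b - η • s) * (profile s : ℂ)
      = (∫ s, (g (b - η • s) - g b) * (profile s : ℂ)) + ((∫ s, profile s : ℝ) : ℂ) * g b := by
    rw [← integral_complex_ofReal, mul_comm, ← integral_const_mul, ← integral_add hdiff hconst]
    refine integral_congr_ae (Eventually.of_forall fun s => ?_)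
    simp only
    ring
  rw [hsplit, add_sub_cancel_right]
  refine (norm_integral_le_of_norm_le (hint.const_mul (M * Real.sqrt η))
    (Eventually.of_forall hbound)).trans (le_of_eq ?_)
  rw [integral_const_mul]
  ring

/-- A smooth function of compact support is Hölder continuous of exponent `1/2`. -/
lemma exists_holder_half {v : (Fin 4 → ℝ) → ℂ} (hv : ContDiff ℝ (⊤ : ℕ∞) v)
    (hc : HasCompactSupport v) :
    ∃ M : ℝ, 0 ≤ M ∧ ∀ x y, ‖v x - v y‖ ≤ M * Real.sqrt ‖x - y‖ := by
  obtain ⟨C, hC⟩ := hv.lipschitzWith_of_hasCompactSupport hc (by simp)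
  obtain ⟨K, hK⟩ := hv.continuous.bounded_above_of_compact_support hc
  have hK0 : 0 ≤ K := (norm_nonneg _).trans (hK 0)
  refine ⟨Real.sqrt (2 * K * C), Real.sqrt_nonneg _, fun x y => ?_⟩
  rw [← Real.sqrt_mul (by positivity)]
  apply Real.le_sqrt_of_sq_le
  have h1 : ‖v x - v y‖ ≤ 2 * K := (norm_sub_le _ _).trans (by linarith [hK x, hK y])
  have h2 : ‖v x - v y‖ ≤ C * ‖x - y‖ := hC.norm_sub_le x y
  calc ‖v x - v y‖ ^ 2 = ‖v x - v y‖ * ‖v x - v y‖ := by ring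
    _ ≤ (2 * K) * (C * ‖x - y‖) := mul_le_mul h1 h2 (norm_nonneg _) (by positivity)
    _ = _ := by ring

/-- The Green identity for `commKernel` recovers `∂_ν u` from `□u` as `η → 0`. -/
lemma exists_norm_integral_pd_commKernel_sub_le {u : (Fin 4 → ℝ) → ℂ} (hu : ContDiff ℝ (⊤ : ℕ∞) u)
    (hc : HasCompactSupport u) {R : ℝ} (hR : 0 ≤ R)
    (hsupp : tsupport u ⊆ {x | 0 < x 0 ∧ ∀ i : Fin 3, |x i.succ| < R}) (ν : Fin 4) :
    ∃ C : ℝ, ∀ η > 0, ∀ b : Fin 4 → ℝ, 0 ≤ b 0 →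
      ‖(∫ x in Icc (lowerCorner R) (upperCorner (b 0) R),
          pd ν (commKernel η) (b - x) * box u x)
        - 4 * Complex.I * ((∫ s, profile s : ℝ) : ℂ) * pd ν u b‖ ≤ C * Real.sqrt η := by
  have hv := hu.pd_smooth ν
  have hvc : HasCompactSupport (pd ν u) := hc.of_isClosed_subset (isClosed_tsupport _)
    (tsupport_pd_subset u ν)
  obtain ⟨M, hM, hh⟩ := exists_holder_half hv hvc
  refine ⟨4 * (M * ∫ s : Fin 3 → ℝ, 4 * (1 + ‖s‖) ^ (-(7 / 2) : ℝ)), fun η hη b hb => ?_⟩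
  have hL := contDiff_commKernel hη.ne'
  have hk : ContDiff ℝ (⊤ : ℕ∞) fun x => commKernel η (b - x) :=
    hL.comp (contDiff_const.sub contDiff_id)
  have hG := integral_pd_mul_box_eq_face hk hu
    (fun x => by rw [box_const_sub_comp hL, box_commKernel hη.ne']) hb hR hsupp
    (fun x hx => commKernel_of_time_zero (by simp [hx])) ν
  have hcons (y : Fin 3 → ℝ) : pd 0 (commKernel η) (b - Fin.cons (b 0) y)
      = 4 * Complex.I * (poissonProfile η (Fin.tail b - y) : ℂ) := by
    rw [pd_zero_commKernel_of_time_zero hη.ne' (by simp)]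
    rfl
  simp only [pd_const_sub_comp hL, neg_neg, hcons] at hG
  have hface : ∫ y in Icc (fun _ : Fin 3 => -R) (fun _ => R),
        -pd ν u (Fin.cons (b 0) y) * -(4 * Complex.I * (poissonProfile η (Fin.tail b - y) : ℂ))
      = 4 * Complex.I *
        ∫ y, pd ν u (Fin.cons (b 0) y) * (poissonProfile η (Fin.tail b - y) : ℂ) := by
    rw [setIntegral_eq_integral_of_forall_compl_eq_zero, ← integral_const_mul]
    · refine integral_congr_ae (Eventually.of_forall fun y => ?_)
      simp only
      ring
    · intro y hy
      have : (Fin.cons (b 0) y : Fin 4 → ℝ) ∉ tsupport u := by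
        intro hmem
        apply hy
        have h := (hsupp hmem).2
        simp only [Fin.cons_succ] at h
        exact ⟨fun i => (abs_lt.1 (h i)).1.le, fun i => (abs_lt.1 (h i)).2.le⟩
      simp [pd_eq_zero_of_notMem_tsupport this]
  rw [hface] at hG
  rw [hG]
  have hcont : Continuous fun y : Fin 3 → ℝ => pd ν u (Fin.cons (b 0) y) :=
    hv.continuous.comp (continuous_const.finCons continuous_id)
  have key := norm_integral_mul_poissonProfile_sub_le hM hcont (fun x y => by
    refine (hh _ _).trans (le_of_eq ?_)
    congr 2
    have : (Fin.cons (b 0) x - Fin.cons (b 0) y : Fin 4 → ℝ) = Fin.cons 0 (x - y) := by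
      funext i
      refine Fin.cases ?_ (fun j => ?_) i <;> simp
    rw [this]
    refine le_antisymm ((pi_norm_le_iff_of_nonneg (norm_nonneg _)).2 fun i => ?_)
      ((pi_norm_le_iff_of_nonneg (norm_nonneg _)).2 fun i => ?_)
    · refine Fin.cases ?_ (fun j => ?_) i
      · simp
      · simpa using norm_le_pi_norm (x - y) j
    · simpa using norm_le_pi_norm (Fin.cons 0 (x - y) : Fin 4 → ℝ) i.succ) (Fin.tail b) hη
  simp only [Fin.cons_self_tail] at key
  rw [mul_assoc (4 * Complex.I), ← mul_sub, norm_mul]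
  have h4 : ‖4 * Complex.I‖ = 4 := by simp
  rw [h4, mul_assoc]
  gcongr

/-! ### Cutting off a wave in the forward cone -/

lemma continuous_mink_self : Continuous fun x : Fin 4 → ℝ => mink x x := by
  unfold mink; fun_prop

lemma contDiff_mink_self : ContDiff ℝ (⊤ : ℕ∞) fun x : Fin 4 → ℝ => mink x x := by
  unfold mink; fun_prop

lemma isOpen_Vplus : IsOpen Vplus :=
  (isOpen_lt continuous_const (continuous_apply 0)).inter
    (isOpen_lt continuous_const continuous_mink_self)

/-- The truncated solid hyperboloid `{x | s ≤ x·x, 0 ≤ x₀ ≤ L}`. -/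
def truncCone (s L : ℝ) : Set (Fin 4 → ℝ) := {x | s ≤ mink x x ∧ 0 ≤ x 0 ∧ x 0 ≤ L}

lemma isClosed_truncCone (s L : ℝ) : IsClosed (truncCone s L) :=
  (isClosed_le continuous_const continuous_mink_self).inter
    ((isClosed_le continuous_const (continuous_apply 0)).inter
      (isClosed_le (continuous_apply 0) continuous_const))

lemma time_pos_of_mem_truncCone {s L : ℝ} (hs : 0 < s) {x : Fin 4 → ℝ}
    (hx : x ∈ truncCone s L) : 0 < x 0 := by
  obtain ⟨h1, h2, -⟩ := hx
  unfold mink at h1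
  nlinarith [sq_nonneg (x 1), sq_nonneg (x 2), sq_nonneg (x 3)]

lemma truncCone_subset_Vplus {s L : ℝ} (hs : 0 < s) : truncCone s L ⊆ Vplus := fun _ hx =>
  ⟨time_pos_of_mem_truncCone hs hx, hs.trans_le hx.1⟩

lemma abs_space_le_of_mem_Vplus {x : Fin 4 → ℝ} (hx : x ∈ Vplus) (i : Fin 3) :
    |x i.succ| ≤ x 0 := by
  obtain ⟨h0, h1⟩ := hx
  unfold mink at h1
  refine abs_le_of_sq_le_sq ?_ h0.le
  fin_cases i <;> simp <;> nlinarith [sq_nonneg (x 1), sq_nonneg (x 2), sq_nonneg (x 3)]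

lemma isCompact_truncCone {s L : ℝ} (hs : 0 < s) : IsCompact (truncCone s L) := by
  refine (isCompact_Icc (a := fun _ : Fin 4 => -L) (b := fun _ => L)).of_isClosed_subset
    (isClosed_truncCone s L) fun x hx => ?_
  have h (i : Fin 4) : |x i| ≤ L := by
    refine Fin.cases ?_ (fun j => ?_) i
    · rw [abs_of_nonneg hx.2.1]; exact hx.2.2
    · exact (abs_space_le_of_mem_Vplus (truncCone_subset_Vplus hs hx) j).trans hx.2.2
  exact ⟨fun i => (abs_le.1 (h i)).1, fun i => (abs_le.1 (h i)).2⟩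

lemma exists_cutoff {Ξ : (Fin 4 → ℝ) → ℂ} (hΞ : ContDiffOn ℝ (⊤ : ℕ∞) Ξ Vplus)
    {s₁ s₂ : ℝ} (h1 : 0 < s₁) (h12 : s₁ < s₂) (L : ℝ) :
    ∃ u : (Fin 4 → ℝ) → ℂ, ContDiff ℝ (⊤ : ℕ∞) u ∧ tsupport u ⊆ truncCone s₁ (L + 1) ∧
      ∀ x ∈ Vplus, s₂ < mink x x → x 0 < L → u =ᶠ[𝓝 x] Ξ := by
  classical
  let h : (Fin 4 → ℝ) → ℝ := fun x =>
    Real.smoothTransition ((mink x x - s₁) / (s₂ - s₁)) * Real.smoothTransition (L + 1 - x 0)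
  have hh : ContDiff ℝ (⊤ : ℕ∞) h :=
    (Real.smoothTransition.contDiff.comp ((contDiff_mink_self.sub contDiff_const).div_const _)).mul
      (Real.smoothTransition.contDiff.comp (contDiff_const.sub (contDiff_apply ℝ ℝ 0)))
  have hzero (x : Fin 4 → ℝ) (hx : mink x x ≤ s₁ ∨ L + 1 ≤ x 0) : h x = 0 := by
    rcases hx with hx | hx
    · have : (mink x x - s₁) / (s₂ - s₁) ≤ 0 :=
        div_nonpos_of_nonpos_of_nonneg (by linarith) (by linarith)
      simp [h, Real.smoothTransition.zero_of_nonpos this]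
    · simp [h, Real.smoothTransition.zero_of_nonpos (show L + 1 - x 0 ≤ 0 by linarith)]
  have hone (x : Fin 4 → ℝ) (hx : s₂ ≤ mink x x) (hx' : x 0 ≤ L) : h x = 1 := by
    have : 1 ≤ (mink x x - s₁) / (s₂ - s₁) := by
      rw [le_div_iff₀ (by linarith)]; linarith
    simp [h, Real.smoothTransition.one_of_one_le this,
      Real.smoothTransition.one_of_one_le (show 1 ≤ L + 1 - x 0 by linarith)]
  let u : (Fin 4 → ℝ) → ℂ := fun x => if x ∈ Vplus then (h x : ℂ) * Ξ x else 0
  have hsub : Function.support u ⊆ truncCone s₁ (L + 1) := by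
    intro x hx
    by_cases hV : x ∈ Vplus
    · by_contra hC
      apply hx
      have : mink x x ≤ s₁ ∨ L + 1 ≤ x 0 := by
        by_contra! hcon
        exact hC ⟨hcon.1.le, hV.1.le, hcon.2.le⟩
      simp [u, hzero x this]
    · exact absurd (by simp [u, hV]) hx
  have hts : tsupport u ⊆ truncCone s₁ (L + 1) := closure_minimal hsub (isClosed_truncCone _ _)
  refine ⟨u, contDiff_iff_contDiffAt.2 fun x => ?_, hts, fun x hV hs hL => ?_⟩
  · by_cases hx : x ∈ Vplus
    · have hu : u =ᶠ[𝓝 x] fun x => (h x : ℂ) * Ξ x := by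
        filter_upwards [isOpen_Vplus.mem_nhds hx] with y hy
        simp [u, hy]
      exact ((Complex.ofRealCLM.contDiff.comp hh).contDiffAt.mul
        (hΞ.contDiffAt (isOpen_Vplus.mem_nhds hx))).congr_of_eventuallyEq hu
    · have : x ∉ tsupport u := fun hx' => hx (truncCone_subset_Vplus h1 (hts hx'))
      exact contDiffAt_const.congr_of_eventuallyEq (notMem_tsupport_iff_eventuallyEq.1 this)
  · filter_upwards [isOpen_Vplus.mem_nhds hV,
      (isOpen_lt continuous_const continuous_mink_self).mem_nhds hs,
      (isOpen_lt (continuous_apply 0) continuous_const).mem_nhds hL] with y hy hys hyL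
    simp [u, hy, hone y hys.le hyL.le]

/-! ### Functionals annihilating the odd derivatives -/

lemma fderiv_eq_sum_pd {E : Type*} [NormedAddCommGroup E] [NormedSpace ℝ E]
    (f : (Fin 4 → ℝ) → E) (x a : Fin 4 → ℝ) : fderiv ℝ f x a = ∑ i, a i • pd i f x := by
  conv_lhs => rw [← Finset.univ_sum_single a]
  rw [map_sum]
  refine Finset.sum_congr rfl fun i _ => ?_
  rw [pd, ← map_smul, ← Pi.single_smul, smul_eq_mul, mul_one]

lemma contDiffAt_pdIter {x : Fin 4 → ℝ} (hx : x ∈ Vplus) (μ : List (Fin 4)) :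
    ContDiffAt ℝ (⊤ : ℕ∞) (pdIter μ fun y => (mink y y)⁻¹) x := by
  induction μ with
  | nil => exact contDiff_mink_self.contDiffAt.inv hx.2.ne'
  | cons i μ ih => exact ih.pd_smooth i

lemma continuousOn_pdIter {B : Set (Fin 4 → ℝ)} (hBV : B ⊆ Vplus) (μ : List (Fin 4)) :
    ContinuousOn (pdIter μ fun y => (mink y y)⁻¹) B := fun _ hx =>
  (contDiffAt_pdIter (hBV hx) μ).continuousAt.continuousWithinAt

/-- The functional `T` vanishes on all `∂_ν ∂_μ (β·β)⁻¹` with `μ` of odd length. -/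
def KillsOdd {B : Set (Fin 4 → ℝ)} (ν : Fin 4) (T : C(B, ℂ) → ℂ) : Prop :=
  ∀ φ : C(B, ℂ), (∃ μ : List (Fin 4), Odd μ.length ∧
    ∀ β : B, φ β = ((pdIter (ν :: μ) (fun y => (mink y y)⁻¹) β : ℝ) : ℂ)) → T φ = 0

lemma contDiffAt_line {g : (Fin 4 → ℝ) → ℝ} {b a : Fin 4 → ℝ} {t : ℝ}
    (hg : ContDiffAt ℝ (⊤ : ℕ∞) g (b - t • a)) :
    ContDiffAt ℝ (⊤ : ℕ∞) (fun s : ℝ => ((g (b - s • a) : ℝ) : ℂ)) t := by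
  have h : ContDiffAt ℝ (⊤ : ℕ∞) (fun s : ℝ => b - s • a) t :=
    contDiffAt_const.sub (contDiffAt_id.smul contDiffAt_const)
  exact Complex.ofRealCLM.contDiff.contDiffAt.comp t (hg.comp t h)

lemma deriv_pd_line {g : (Fin 4 → ℝ) → ℝ} {b a : Fin 4 → ℝ} {t : ℝ}
    (hg : ContDiffAt ℝ (⊤ : ℕ∞) g (b - t • a)) (ν : Fin 4) :
    deriv (fun s : ℝ => ((pd ν g (b - s • a) : ℝ) : ℂ)) t
      = ∑ i, (-(a i : ℂ)) * ((pd ν (pd i g) (b - t • a) : ℝ) : ℂ) := by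
  have h1 : HasDerivAt (fun s : ℝ => b - s • a) (-a) t := by
    simpa using ((hasDerivAt_id t).smul_const a).const_sub b
  have h2 := (hg.pd_smooth ν).differentiableAt_smooth.hasFDerivAt.comp_hasDerivAt t h1
  have h3 := h2.ofReal_comp.deriv
  refine h3.trans ?_
  rw [map_neg, fderiv_eq_sum_pd]
  push_cast
  rw [← Finset.sum_neg_distrib]
  refine Finset.sum_congr rfl fun i _ => ?_
  rw [pd_comm hg i ν, smul_eq_mul]
  push_cast
  ring

lemma exists_iteratedDeriv_line_mem_ker {B : Set (Fin 4 → ℝ)} [CompactSpace B] (hBV : B ⊆ Vplus)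
    {ν : Fin 4} {T : C(B, ℂ) →L[ℂ] ℂ} (hT : KillsOdd ν T) (a : Fin 4 → ℝ) (n : ℕ) :
    ∀ μ : List (Fin 4), Odd (n + μ.length) → ∃ φ : C(B, ℂ), T φ = 0 ∧ ∀ β : B,
      φ β = iteratedDeriv n (fun t : ℝ =>
        ((pd ν (pdIter μ fun y => (mink y y)⁻¹) ((β : Fin 4 → ℝ) - t • a) : ℝ) : ℂ)) 0 := by
  induction n with
  | zero =>
    intro μ hμ
    rw [zero_add] at hμ
    let φ : C(B, ℂ) := ⟨fun β => ((pdIter (ν :: μ) (fun y => (mink y y)⁻¹) β : ℝ) : ℂ),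
      Complex.continuous_ofReal.comp
        (continuousOn_iff_continuous_domRestrict.1 (continuousOn_pdIter hBV (ν :: μ)))⟩
    exact ⟨φ, hT φ ⟨μ, hμ, fun β => rfl⟩, fun β => by simp [φ, pdIter]⟩
  | succ n ih =>
    intro μ hμ
    choose φ hφ hval using fun i : Fin 4 => ih (i :: μ) (by
      rw [List.length_cons, ← add_assoc, add_right_comm]; exact hμ)
    refine ⟨∑ i, (-(a i : ℂ)) • φ i, by simp [hφ], fun β => ?_⟩
    have hev : ∀ᶠ t : ℝ in 𝓝 0, (β : Fin 4 → ℝ) - t • a ∈ Vplus := by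
      have hc : ContinuousAt (fun t : ℝ => (β : Fin 4 → ℝ) - t • a) 0 := by fun_prop
      exact hc.eventually_mem (isOpen_Vplus.mem_nhds (by simpa using hBV β.2))
    have hd : deriv (fun t : ℝ =>
        ((pd ν (pdIter μ fun y => (mink y y)⁻¹) ((β : Fin 4 → ℝ) - t • a) : ℝ) : ℂ))
        =ᶠ[𝓝 0] fun t => ∑ i, (-(a i : ℂ)) *
          ((pd ν (pdIter (i :: μ) fun y => (mink y y)⁻¹) ((β : Fin 4 → ℝ) - t • a) : ℝ) : ℂ) := by
      filter_upwards [hev] with t ht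
      exact deriv_pd_line (contDiffAt_pdIter ht μ) ν
    have hcd (i : Fin 4) : ContDiffAt ℝ (n : ℕ∞) (fun t : ℝ =>
        ((pd ν (pdIter (i :: μ) fun y => (mink y y)⁻¹) ((β : Fin 4 → ℝ) - t • a) : ℝ) : ℂ)) 0 :=
      (contDiffAt_line ((contDiffAt_pdIter (by simpa using hBV β.2) (i :: μ)).pd_smooth ν)).of_le
        (by exact_mod_cast le_top)
    rw [iteratedDeriv_succ', (hd.iteratedDeriv n).eq_of_nhds,
      iteratedDeriv_fun_sum fun i _ => contDiffAt_const.mul (hcd i)]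
    simp only [iteratedDeriv_const_mul_field, ContinuousMap.coe_sum, Finset.sum_apply,
      ContinuousMap.smul_apply, smul_eq_mul, hval]

/-- The `i`-th coordinate as a complex function on `B`. -/
def coordFn (B : Set (Fin 4 → ℝ)) (i : Fin 4) : C(B, ℂ) :=
  ⟨fun β => (((β : Fin 4 → ℝ) i : ℝ) : ℂ),
    Complex.continuous_ofReal.comp ((continuous_apply i).comp continuous_subtype_val)⟩

/-- The function `β ↦ (β - z)·(β - z)` on `B`, for complex `z`. -/
def sqFn (B : Set (Fin 4 → ℝ)) (z : Fin 4 → ℂ) : C(B, ℂ) :=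
  (coordFn B 0 - z 0 • 1) ^ 2 - (coordFn B 1 - z 1 • 1) ^ 2 - (coordFn B 2 - z 2 • 1) ^ 2
    - (coordFn B 3 - z 3 • 1) ^ 2

/-- The function `β ↦ ∂_ν (w·w)⁻¹` at `w = β - z`, as an element of `C(B, ℂ)`. -/
def gradFn (B : Set (Fin 4 → ℝ)) (ν : Fin 4) (z : Fin 4 → ℂ) : C(B, ℂ) :=
  (-2 * (metricSign ν : ℂ)) • ((coordFn B ν - z ν • 1) * Ring.inverse (sqFn B z) ^ 2)

/-- The complex vectors `z` for which `β - z` is never null, `β ∈ B`. -/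
def nonNull (B : Set (Fin 4 → ℝ)) : Set (Fin 4 → ℂ) :=
  {z | ∀ β : B, minkSqC (fun i => (((β : Fin 4 → ℝ) i : ℝ) : ℂ) - z i) ≠ 0}

lemma sqFn_apply {B : Set (Fin 4 → ℝ)} (z : Fin 4 → ℂ) (β : B) :
    sqFn B z β = minkSqC fun i => (((β : Fin 4 → ℝ) i : ℝ) : ℂ) - z i := by
  simp [sqFn, coordFn, minkSqC]

lemma isUnit_sqFn {B : Set (Fin 4 → ℝ)} {z : Fin 4 → ℂ} (hz : z ∈ nonNull B) :
    IsUnit (sqFn B z) := by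
  rw [ContinuousMap.isUnit_iff_forall_ne_zero]
  intro β
  rw [sqFn_apply]
  exact hz β

lemma gradFn_apply {B : Set (Fin 4 → ℝ)} (ν : Fin 4) {z : Fin 4 → ℂ} (hz : z ∈ nonNull B)
    (β : B) : gradFn B ν z β = gradInvSq ν fun i => (((β : Fin 4 → ℝ) i : ℝ) : ℂ) - z i := by
  have h : Ring.inverse (sqFn B z) β = (sqFn B z β)⁻¹ := by
    have := congrArg (fun f : C(B, ℂ) => f β) (Ring.inverse_mul_cancel _ (isUnit_sqFn hz))
    exact eq_inv_of_mul_eq_one_left this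
  simp only [gradFn, gradInvSq, ContinuousMap.smul_apply, ContinuousMap.mul_apply,
    ContinuousMap.pow_apply, h, sqFn_apply, smul_eq_mul]
  simp [coordFn]
  ring

lemma analyticAt_gradFn {B : Set (Fin 4 → ℝ)} [CompactSpace B] (ν : Fin 4) {z : Fin 4 → ℂ}
    (hz : z ∈ nonNull B) : AnalyticAt ℂ (gradFn B ν) z := by
  have hcoord (i : Fin 4) :
      AnalyticAt ℂ (fun z : Fin 4 → ℂ => coordFn B i - z i • (1 : C(B, ℂ))) z :=
    analyticAt_const.sub
      (((ContinuousLinearMap.proj (R := ℂ) (φ := fun _ : Fin 4 => ℂ) i).analyticAt z).smul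
        analyticAt_const)
  have hsq : AnalyticAt ℂ (sqFn B) z :=
    ((((hcoord 0).pow 2).sub ((hcoord 1).pow 2)).sub ((hcoord 2).pow 2)).sub ((hcoord 3).pow 2)
  have hinv : AnalyticAt ℂ (fun z => Ring.inverse (sqFn B z)) z :=
    (analyticOnNhd_inverse (𝕜 := ℂ) (A := C(B, ℂ)) _ (isUnit_sqFn hz)).comp hsq
  have hc : AnalyticAt ℂ (fun _ : Fin 4 → ℂ => -2 * (metricSign ν : ℂ)) z := analyticAt_const
  exact hc.smul ((hcoord ν).mul (hinv.pow 2))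

/-- The complex vector with real part `a`, moved by `τ` in the time direction. -/
def complexPoint (a : Fin 4 → ℝ) (τ : ℂ) : Fin 4 → ℂ :=
  fun i => (a i : ℂ) + if i = 0 then τ else 0

lemma neg_complexPoint (a : Fin 4 → ℝ) (τ : ℂ) :
    -complexPoint a τ = complexPoint (-a) (-τ) := by
  funext i
  by_cases hi : i = 0 <;> simp [complexPoint, hi]
  ring

lemma sub_complexPoint (b a : Fin 4 → ℝ) (τ : ℂ) :
    (fun i => (b i : ℂ) - complexPoint a τ i)
      = timeShift τ.im (b - a - Pi.single 0 τ.re) := by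
  funext i
  by_cases hi : i = 0
  · subst hi
    apply Complex.ext <;> simp [timeShift, complexPoint]
    ring
  · simp [timeShift, complexPoint, hi]

lemma complexPoint_mem_nonNull {B : Set (Fin 4 → ℝ)} {a : Fin 4 → ℝ} {τ : ℂ}
    (h : τ.im ≠ 0 ∨ ∀ β ∈ B, β - a - Pi.single 0 τ.re ∈ Vplus) :
    complexPoint a τ ∈ nonNull B := by
  intro β
  rw [sub_complexPoint]
  apply minkSqC_timeShift_ne_zero
  rcases h with h | h
  · exact Or.inr h
  · exact Or.inl (h β β.2).2.ne'

lemma analyticAt_complexPoint (a : Fin 4 → ℝ) (τ : ℂ) : AnalyticAt ℂ (complexPoint a) τ := by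
  rw [analyticAt_pi_iff]
  intro i
  by_cases hi : i = 0
  · simp only [complexPoint, hi, if_true]
    exact analyticAt_const.add analyticAt_id
  · simp only [complexPoint, hi, if_false]
    exact analyticAt_const

lemma analyticAt_complexPoint_smul (a : Fin 4 → ℝ) (τ : ℂ) (t : ℝ) :
    AnalyticAt ℝ (fun s : ℝ => complexPoint (s • a) τ) t := by
  rw [analyticAt_pi_iff]
  intro i
  have h : AnalyticAt ℝ (fun s : ℝ => (s : ℂ)) t := Complex.ofRealCLM.analyticAt t
  simp only [complexPoint, Pi.smul_apply, smul_eq_mul, Complex.ofReal_mul]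
  exact (h.mul analyticAt_const).add analyticAt_const

/-- The part of `z ↦ T (gradFn B ν z)` that is odd under `z ↦ -z`. -/
def oddPart {B : Set (Fin 4 → ℝ)} (ν : Fin 4) (T : C(B, ℂ) → ℂ) (z : Fin 4 → ℂ) : ℂ :=
  T (gradFn B ν z) - T (gradFn B ν (-z))

lemma analyticAt_oddPart {B : Set (Fin 4 → ℝ)} [CompactSpace B] (ν : Fin 4)
    (T : C(B, ℂ) →L[ℂ] ℂ) {z : Fin 4 → ℂ} (h1 : z ∈ nonNull B) (h2 : -z ∈ nonNull B) :
    AnalyticAt ℂ (oddPart ν T) z :=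
  ((T.analyticAt _).comp (analyticAt_gradFn ν h1)).sub
    ((T.analyticAt _).comp ((analyticAt_gradFn ν h2).comp analyticAt_id.neg))

lemma pd_inv_mink_eq_gradInvSq {x : Fin 4 → ℝ} (hx : x ∈ Vplus) (ν : Fin 4) :
    ((pd ν (fun y => (mink y y)⁻¹) x : ℝ) : ℂ) = gradInvSq ν (timeShift 0 x) := by
  rw [← pd_inv_minkSqC_timeShift (Or.inl hx.2.ne')]
  have h : (fun y => (minkSqC (timeShift 0 y))⁻¹)
      = fun y => (((mink y y)⁻¹ : ℝ) : ℂ) := by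
    funext y
    simp [minkSqC, timeShift, mink, pow_two]
  rw [h]
  have hd := (contDiffAt_pdIter hx []).differentiableAt_smooth.hasFDerivAt
  have h2 := (Complex.ofRealCLM.hasFDerivAt.comp x hd).fderiv
  exact (DFunLike.congr_fun h2 (Pi.single ν 1)).symm

/-- The odd part vanishes on small real vectors. -/
lemma oddPart_eq_zero_of_real {B : Set (Fin 4 → ℝ)} [CompactSpace B] {ν : Fin 4}
    {T : C(B, ℂ) →L[ℂ] ℂ} (hT : KillsOdd ν T) {a : Fin 4 → ℝ}
    (ha : ∀ t ∈ Icc (-1 : ℝ) 1, ∀ β ∈ B, β - t • a ∈ Vplus) :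
    oddPart ν T (complexPoint a 0) = 0 := by
  have hBV : B ⊆ Vplus := fun β hβ => by simpa using ha 0 (by norm_num) β hβ
  have hmem (t : ℝ) (ht : t ∈ Icc (-1 : ℝ) 1) : complexPoint (t • a) 0 ∈ nonNull B :=
    complexPoint_mem_nonNull (Or.inr fun β hβ => by simpa using ha t ht β hβ)
  have hneg (t : ℝ) : -complexPoint (t • a) 0 = complexPoint ((-t) • a) 0 := by
    rw [neg_complexPoint, neg_zero, neg_smul]
  let ψ : ℝ → C(B, ℂ) := fun t => gradFn B ν (complexPoint (t • a) 0)
  have hψ (t : ℝ) (ht : t ∈ Icc (-1 : ℝ) 1) : AnalyticAt ℝ ψ t :=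
    AnalyticAt.comp (g := gradFn B ν) (f := fun s : ℝ => complexPoint (s • a) 0)
      (analyticAt_gradFn ν (hmem t ht)).restrictScalars (analyticAt_complexPoint_smul a 0 t)
  let T' : C(B, ℂ) →L[ℝ] ℂ := T.restrictScalars ℝ
  let φ : ℝ → ℂ := fun t => T' (ψ t) - T' (ψ (-t))
  have hφ : AnalyticOnNhd ℝ φ (Icc (-1) 1) := fun t ht =>
    ((T'.analyticAt _).comp (hψ t ht)).sub
      ((T'.analyticAt _).comp ((hψ (-t) ⟨by linarith [ht.2], by linarith [ht.1]⟩).comp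
        analyticAt_id.neg))
  have h0 : (0 : ℝ) ∈ Icc (-1 : ℝ) 1 := by norm_num
  have hclm (F : C(B, ℂ) →L[ℝ] ℂ) (n : ℕ) :
      iteratedDeriv n (fun t => F (ψ t)) 0 = F (iteratedDeriv n ψ 0) := by
    have := F.iteratedFDeriv_comp_left (f := ψ) (x := 0) (n := n) ((hψ 0 h0).contDiffAt) (i := n)
      le_rfl
    simp only [iteratedDeriv]
    exact congrArg (fun m => m fun _ => 1) this
  have hodd (n : ℕ) (hn : Odd n) : T' (iteratedDeriv n ψ 0) = 0 := by
    obtain ⟨χ, hχ, hχ'⟩ := exists_iteratedDeriv_line_mem_ker hBV hT a n [] (by simpa using hn)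
    suffices h : iteratedDeriv n ψ 0 = χ by rw [h]; exact hχ
    ext β
    rw [hχ' β]
    let ev : C(B, ℂ) →L[ℝ] ℂ := ContinuousMap.evalCLM ℝ β
    rw [show iteratedDeriv n ψ 0 β = ev (iteratedDeriv n ψ 0) from rfl, ← hclm ev n]
    refine Filter.EventuallyEq.eq_of_nhds (EventuallyEq.iteratedDeriv ?_ n)
    filter_upwards [Icc_mem_nhds (show (-1 : ℝ) < 0 by norm_num) (show (0 : ℝ) < 1 by norm_num)]
      with t ht
    rw [show ev (ψ t) = ψ t β from rfl, gradFn_apply ν (hmem t ht), sub_complexPoint]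
    simpa [pdIter] using (pd_inv_mink_eq_gradInvSq (ha t ht β β.2) ν).symm
  have hzero : ∀ᶠ t in 𝓝 (0 : ℝ), φ t = 0 := by
    rw [← analyticOrderAt_eq_top, ENat.eq_top_iff_forall_ge]
    intro n
    rw [natCast_le_analyticOrderAt_iff_iteratedDeriv_eq_zero (hφ 0 h0)]
    intro i _
    have hc : ContDiffAt ℝ i (fun t => T' (ψ t)) 0 :=
      ((T'.analyticAt _).comp (hψ 0 h0)).contDiffAt
    have hc' : ContDiffAt ℝ i (fun t => T' (ψ (-t))) 0 :=
      ((T'.analyticAt _).comp (AnalyticAt.comp (g := ψ) (f := fun t : ℝ => -t) (x := 0)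
        (by simpa using hψ 0 h0) analyticAt_id.neg)).contDiffAt
    rw [show φ = fun t => T' (ψ t) - T' (ψ (-t)) from rfl, iteratedDeriv_fun_sub hc hc',
      iteratedDeriv_comp_neg i (fun t => T' (ψ t)), neg_zero, hclm]
    rcases Nat.even_or_odd i with hi | hi
    · simp [hi.neg_one_pow]
    · simp [hodd i hi]
  have h1 := hφ.eqOn_zero_of_preconnected_of_eventuallyEq_zero isPreconnected_Icc h0 hzero
    (show (1 : ℝ) ∈ Icc (-1 : ℝ) 1 by norm_num)
  have h2 : oddPart ν T (complexPoint ((1 : ℝ) • a) 0) = 0 := by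
    rw [oddPart, hneg]
    exact h1
  simpa using h2

/-- The odd part vanishes on all points `a + iηe₀` with `η ≠ 0`. -/
lemma oddPart_eq_zero {B : Set (Fin 4 → ℝ)} [CompactSpace B] (hBV : B ⊆ Vplus) {ν : Fin 4}
    {T : C(B, ℂ) →L[ℂ] ℂ} (hT : KillsOdd ν T) (a : Fin 4 → ℝ) {η : ℝ} (hη : η ≠ 0) :
    oddPart ν T (complexPoint a (η * Complex.I)) = 0 := by
  obtain ⟨r, hr, hrV⟩ :=
    (isCompact_iff_compactSpace.2 ‹_› : IsCompact B).exists_thickening_subset_open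
    isOpen_Vplus hBV
  have hsmall (c : Fin 4 → ℝ) (hc : ‖c‖ < r) (β : Fin 4 → ℝ) (hβ : β ∈ B) : β - c ∈ Vplus :=
    hrV (Metric.mem_thickening_iff.2 ⟨β, hβ, by simpa [dist_eq_norm] using hc⟩)
  have hsum (c : Fin 4 → ℝ) (hc : ‖c‖ < r / 2) (x : ℝ) (hx : |x| < r / 2) :
      ‖c + Pi.single 0 x‖ < r := by
    have : ‖(Pi.single 0 x : Fin 4 → ℝ)‖ = |x| := by rw [Pi.norm_single, Real.norm_eq_abs]
    linarith [norm_add_le c (Pi.single 0 x)]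
  have hreal (c : Fin 4 → ℝ) (hc : ‖c‖ < r) : oddPart ν T (complexPoint c 0) = 0 := by
    refine oddPart_eq_zero_of_real hT fun t ht β hβ => hsmall _ ?_ β hβ
    rw [norm_smul, Real.norm_eq_abs]
    have := abs_le.2 ht
    nlinarith [norm_nonneg c, abs_nonneg t]
  have hstrip (c : Fin 4 → ℝ) (hc : ‖c‖ < r / 2) :
      oddPart ν T (complexPoint c (η * Complex.I)) = 0 := by
    let S : Set ℂ := {τ | |τ.re| < r / 2}
    have hS : Convex ℝ S := by
      have : S = Complex.reCLM ⁻¹' Ioo (-(r / 2)) (r / 2) := by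
        ext τ; simp [S, abs_lt]
      rw [this]
      exact (convex_Ioo _ _).linear_preimage Complex.reCLM.toLinearMap
    have hA : AnalyticOnNhd ℂ (fun τ => oddPart ν T (complexPoint c τ)) S := by
      intro τ hτ
      refine AnalyticAt.comp (g := oddPart ν T) (f := complexPoint c) (analyticAt_oddPart ν T ?_ ?_)
        (analyticAt_complexPoint c τ)
      · refine complexPoint_mem_nonNull (Or.inr fun β hβ => ?_)
        rw [sub_sub]
        exact hsmall _ (hsum c hc _ hτ) β hβ
      · rw [neg_complexPoint]
        refine complexPoint_mem_nonNull (Or.inr fun β hβ => ?_)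
        rw [sub_sub]
        exact hsmall _ (hsum (-c) (by simpa using hc) _ (by simpa [S] using hτ)) β hβ
    have hfreq : ∃ᶠ τ in 𝓝[≠] (0 : ℂ), oddPart ν T (complexPoint c τ) = 0 := by
      have ht : Tendsto (fun x : ℝ => (x : ℂ)) (𝓝[≠] 0) (𝓝[≠] 0) := by
        refine tendsto_nhdsWithin_of_tendsto_nhds_of_eventually_within _ ?_ ?_
        · exact (Complex.continuous_ofReal.tendsto' 0 0 (by simp)).mono_left nhdsWithin_le_nhds
        · filter_upwards [self_mem_nhdsWithin] with x hx
          simpa using hx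
      refine ht.frequently (Eventually.frequently ?_)
      have hx : ∀ᶠ x : ℝ in 𝓝 0, |x| < r / 2 :=
        (continuous_abs.tendsto' (0 : ℝ) 0 abs_zero).eventually_lt_const (by linarith)
      filter_upwards [nhdsWithin_le_nhds hx] with x hx
      have : complexPoint c (x : ℂ) = complexPoint (c + Pi.single 0 x) 0 := by
        funext i
        by_cases hi : i = 0 <;> simp [complexPoint, hi]
      rw [this]
      exact hreal _ (hsum c hc x hx)
    exact hA.eqOn_zero_of_preconnected_of_frequently_eq_zero hS.isPreconnected
      (show (0 : ℂ) ∈ S by simpa [S] using hr) hfreq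
      (show (η * Complex.I : ℂ) ∈ S by simpa [S] using hr)
  have hA : AnalyticOnNhd ℝ (fun s : ℝ => oddPart ν T (complexPoint (s • a) (η * Complex.I)))
      univ := by
    intro s _
    refine AnalyticAt.comp (g := oddPart ν T)
      (f := fun s : ℝ => complexPoint (s • a) (η * Complex.I))
      (analyticAt_oddPart ν T ?_ ?_).restrictScalars (analyticAt_complexPoint_smul a _ s)
    · exact complexPoint_mem_nonNull (Or.inl (by simpa using hη))
    · rw [neg_complexPoint]
      exact complexPoint_mem_nonNull (Or.inl (by simpa using hη))
  have hev : ∀ᶠ s : ℝ in 𝓝 0, oddPart ν T (complexPoint (s • a) (η * Complex.I)) = 0 := by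
    have hc : Tendsto (fun s : ℝ => ‖s • a‖) (𝓝 0) (𝓝 0) :=
      Continuous.tendsto' (by fun_prop) _ _ (by simp)
    filter_upwards [hc.eventually_lt_const (half_pos hr)] with s hs
    exact hstrip _ hs
  simpa using hA.eqOn_zero_of_preconnected_of_eventuallyEq_zero isPreconnected_univ
    (mem_univ 0) hev (mem_univ (1 : ℝ))

/-- The function `β ↦ ∂_ν K_η(β - a) + ∂_ν K_η(β + a)` on `B`, where `K_η` is `commKernel η`. -/
def evenKernel (B : Set (Fin 4 → ℝ)) (ν : Fin 4) (η : ℝ) (a : Fin 4 → ℝ) : C(B, ℂ) :=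
  (gradFn B ν (complexPoint a (η * Complex.I)) - gradFn B ν (-complexPoint a (η * Complex.I)))
    - (gradFn B ν (complexPoint a ((-η : ℝ) * Complex.I))
      - gradFn B ν (-complexPoint a ((-η : ℝ) * Complex.I)))

lemma map_evenKernel {B : Set (Fin 4 → ℝ)} [CompactSpace B] (hBV : B ⊆ Vplus) {ν : Fin 4}
    {T : C(B, ℂ) →L[ℂ] ℂ} (hT : KillsOdd ν T) {η : ℝ} (hη : η ≠ 0) (a : Fin 4 → ℝ) :
    T (evenKernel B ν η a) = 0 := by
  have h1 := oddPart_eq_zero hBV hT a hη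
  have h2 := oddPart_eq_zero hBV hT a (neg_ne_zero.2 hη)
  rw [oddPart] at h1 h2
  rw [evenKernel, map_sub, map_sub, map_sub, h1, h2, sub_zero]

lemma evenKernel_apply {B : Set (Fin 4 → ℝ)} (ν : Fin 4) {η : ℝ} (hη : η ≠ 0)
    (a : Fin 4 → ℝ) (β : B) :
    evenKernel B ν η a β = pd ν (commKernel η) (β - a) + pd ν (commKernel η) (β + a) := by
  have h (c : Fin 4 → ℝ) {s : ℝ} (hs : s ≠ 0) :
      gradFn B ν (complexPoint c (s * Complex.I)) β = gradInvSq ν (timeShift s (β - c)) := by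
    rw [gradFn_apply ν (complexPoint_mem_nonNull (Or.inl (by simpa using hs))), sub_complexPoint]
    simp
  have h' (c : Fin 4 → ℝ) {s : ℝ} (hs : s ≠ 0) :
      gradFn B ν (-complexPoint c (s * Complex.I)) β = gradInvSq ν (timeShift (-s) (β + c)) := by
    rw [neg_complexPoint, ← neg_mul, ← Complex.ofReal_neg, h _ (neg_ne_zero.2 hs), sub_neg_eq_add]
  simp only [evenKernel, ContinuousMap.sub_apply, h _ hη, h' _ hη, h _ (neg_ne_zero.2 hη),
    h' _ (neg_ne_zero.2 hη), pd_commKernel hη, neg_neg]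
  ring

lemma continuous_evenKernel (B : Set (Fin 4 → ℝ)) [CompactSpace B] (ν : Fin 4) {η : ℝ}
    (hη : η ≠ 0) : Continuous (evenKernel B ν η) := by
  have h {s : ℝ} (hs : s ≠ 0) :
      Continuous fun a : Fin 4 → ℝ => gradFn B ν (complexPoint a (s * Complex.I)) := by
    refine continuous_iff_continuousAt.2 fun a => ContinuousAt.comp (g := gradFn B ν)
      (f := fun a => complexPoint a (s * Complex.I))
      (analyticAt_gradFn ν (complexPoint_mem_nonNull (Or.inl (by simpa using hs)))).continuousAt ?_
    refine Continuous.continuousAt (continuous_pi fun i => ?_)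
    exact (Complex.continuous_ofReal.comp (continuous_apply i)).add continuous_const
  have h' {s : ℝ} (hs : s ≠ 0) :
      Continuous fun a : Fin 4 → ℝ => gradFn B ν (-complexPoint a (s * Complex.I)) := by
    simp only [neg_complexPoint, ← neg_mul, ← Complex.ofReal_neg]
    exact (h (neg_ne_zero.2 hs)).comp continuous_neg
  have hneg := neg_ne_zero.2 hη
  exact ((h hη).sub (h' hη)).sub ((h hneg).sub (h' hneg))

/-! ### The approximate identity applied to the cut-off wave -/

lemma mink_nonneg_of_mem_Vplus {b d : Fin 4 → ℝ} (hb : b ∈ Vplus) (h0 : 0 ≤ d 0)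
    (hd : 0 ≤ mink d d) : 0 ≤ mink b d := by
  obtain ⟨hb0, hb1⟩ := hb
  have h : |b 1 * d 1 + b 2 * d 2 + b 3 * d 3| ≤ b 0 * d 0 := by
    refine abs_le_of_sq_le_sq ?_ (by positivity)
    have hcs : (b 1 * d 1 + b 2 * d 2 + b 3 * d 3) ^ 2
        ≤ (b 1 ^ 2 + b 2 ^ 2 + b 3 ^ 2) * (d 1 ^ 2 + d 2 ^ 2 + d 3 ^ 2) := by
      nlinarith [sq_nonneg (b 1 * d 2 - b 2 * d 1), sq_nonneg (b 1 * d 3 - b 3 * d 1),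
        sq_nonneg (b 2 * d 3 - b 3 * d 2)]
    have h1 : b 1 ^ 2 + b 2 ^ 2 + b 3 ^ 2 ≤ b 0 ^ 2 := by unfold mink at hb1; linarith
    have h2 : d 1 ^ 2 + d 2 ^ 2 + d 3 ^ 2 ≤ d 0 ^ 2 := by unfold mink at hd; linarith
    rw [mul_pow]
    exact hcs.trans (mul_le_mul h1 h2 (by positivity) (by positivity))
  have := (abs_le.1 h).2
  unfold mink
  linarith

lemma mink_add_self (b d : Fin 4 → ℝ) :
    mink (b + d) (b + d) = mink b b + 2 * mink b d + mink d d := by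
  simp [mink]; ring

/-- Away from the light cone, the two boundary values of `gradInvSq` agree. -/
lemma eventually_norm_gradInvSq_sub_le {X : Set (Fin 4 → ℝ)} (hX : IsCompact X)
    (h0 : ∀ x ∈ X, mink x x ≠ 0) (ν : Fin 4) {δ : ℝ} (hδ : 0 < δ) :
    ∀ᶠ η : ℝ in 𝓝 0, ∀ x ∈ X,
      ‖gradInvSq ν (timeShift η x) - gradInvSq ν (timeShift (-η) x)‖ < δ := by
  refine hX.eventually_forall_of_forall_eventually fun x hx => ?_
  have hsh : Continuous fun p : ℝ × (Fin 4 → ℝ) => timeShift p.1 p.2 := by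
    refine continuous_pi fun i => ?_
    unfold timeShift
    by_cases hi : i = 0
    · simp only [hi, if_true]; fun_prop
    · simp only [hi, if_false]; fun_prop
  have hg {w : Fin 4 → ℂ} (hw : minkSqC w ≠ 0) : ContinuousAt (gradInvSq ν) w := by
    have hm : ContinuousAt minkSqC w := by unfold minkSqC; fun_prop
    have h := (((continuousAt_const (y := -2 * (metricSign ν : ℂ))).mul
      (continuous_apply ν).continuousAt).mul ((hm.inv₀ hw).pow 2))
    exact h
  have hne : minkSqC (timeShift 0 x) ≠ 0 := minkSqC_timeShift_ne_zero (Or.inl (h0 x hx))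
  have h1 : ContinuousAt (fun p : ℝ × (Fin 4 → ℝ) => gradInvSq ν (timeShift p.1 p.2)) (0, x) :=
    ContinuousAt.comp (g := gradInvSq ν) (hg hne) hsh.continuousAt
  have h2 : ContinuousAt (fun p : ℝ × (Fin 4 → ℝ) => gradInvSq ν (timeShift (-p.1) p.2)) (0, x) :=
    ContinuousAt.comp (g := gradInvSq ν)
      (f := fun p : ℝ × (Fin 4 → ℝ) => timeShift (-p.1) p.2) (hg (by simpa using hne))
      (hsh.comp ((continuous_fst.neg).prodMk continuous_snd)).continuousAt
  have h3 := (h1.sub h2).norm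
  have h4 : Tendsto (fun p : ℝ × (Fin 4 → ℝ) =>
      ‖gradInvSq ν (timeShift p.1 p.2) - gradInvSq ν (timeShift (-p.1) p.2)‖) (𝓝 (0, x)) (𝓝 0) := by
    simpa [ContinuousAt] using h3
  exact h4.eventually_lt_const hδ

lemma eventually_norm_integral_even_sub_le {u : (Fin 4 → ℝ) → ℂ} (hu : ContDiff ℝ (⊤ : ℕ∞) u)
    {s₁ s₂ L : ℝ} (hs : 0 < s₁) (hL : 0 ≤ L) (hts : tsupport u ⊆ truncCone s₁ (L + 2))
    (hwave : ∀ x ∈ Vplus, x 0 ≤ L → s₂ < mink x x → box u x = 0)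
    {B : Set (Fin 4 → ℝ)} (hB : IsCompact B) (hBV : B ⊆ Vplus) (hBs : ∀ β ∈ B, s₂ < mink β β)
    (hBL : ∀ β ∈ B, β 0 ≤ L) (ν : Fin 4) {ε : ℝ} (hε : 0 < ε) :
    ∀ᶠ η : ℝ in 𝓝[>] 0, ∀ β ∈ B,
      ‖(∫ x in Icc (lowerCorner (L + 3)) (upperCorner L (L + 3)),
          box u x * (pd ν (commKernel η) (β - x) + pd ν (commKernel η) (β + x)))
        - 4 * Complex.I * ((∫ s, profile s : ℝ) : ℂ) * pd ν u β‖ ≤ ε := by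
  have hc : HasCompactSupport u :=
    (isCompact_truncCone hs).of_isClosed_subset (isClosed_tsupport u) hts
  have hsupp : tsupport u ⊆ {x | 0 < x 0 ∧ ∀ i : Fin 3, |x i.succ| < L + 3} := fun x hx =>
    ⟨time_pos_of_mem_truncCone hs (hts hx), fun i =>
      ((abs_space_le_of_mem_Vplus (truncCone_subset_Vplus hs (hts hx)) i).trans
        (hts hx).2.2).trans_lt (by linarith)⟩
  obtain ⟨C, hC⟩ := exists_norm_integral_pd_commKernel_sub_le hu hc (by linarith : 0 ≤ L + 3)
    hsupp ν
  have hbcont : Continuous (box u) := hu.box_smooth.continuous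
  obtain ⟨M, hM⟩ : ∃ M, ∀ x, ‖box u x‖ ≤ M := by
    refine hbcont.bounded_above_of_compact_support ?_
    refine HasCompactSupport.intro' hc (isClosed_tsupport u) fun x hx => ?_
    exact box_eq_zero_of_notMem_tsupport hx
  have hM0 : 0 ≤ M := (norm_nonneg _).trans (hM 0)
  set Q : Set (Fin 4 → ℝ) := Icc (lowerCorner (L + 3)) (upperCorner L (L + 3)) with hQ
  have hQc : IsCompact Q := isCompact_Icc
  let X₁ : Set (Fin 4 → ℝ) := (fun p : (Fin 4 → ℝ) × (Fin 4 → ℝ) => p.1 - p.2) ''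
    ((B ×ˢ truncCone s₁ L) ∩ {p | mink p.2 p.2 ≤ s₂ ∧ p.1 0 ≤ p.2 0})
  let X₂ : Set (Fin 4 → ℝ) := (fun p : (Fin 4 → ℝ) × (Fin 4 → ℝ) => p.1 + p.2) ''
    (B ×ˢ truncCone s₁ L)
  have hX₁ : IsCompact X₁ := by
    refine ((hB.prod (isCompact_truncCone hs)).inter_right ?_).image (by fun_prop)
    exact (isClosed_le (continuous_mink_self.comp continuous_snd) continuous_const).inter
      (isClosed_le ((continuous_apply 0).comp continuous_fst)
        ((continuous_apply 0).comp continuous_snd))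
  have hX₂ : IsCompact X₂ := (hB.prod (isCompact_truncCone hs)).image (by fun_prop)
  have hX₁0 : ∀ x ∈ X₁, mink x x ≠ 0 := by
    rintro _ ⟨⟨b, a⟩, ⟨⟨hb, ha⟩, has, hab⟩, rfl⟩ h0
    simp only at hb ha has hab h0
    have hd : mink (a - b) (a - b) = 0 := by
      rw [← h0]; simp [mink]; ring
    have h1 := mink_nonneg_of_mem_Vplus (hBV hb) (d := a - b) (by simpa using hab) hd.ge
    have h2 := mink_add_self b (a - b)
    rw [add_sub_cancel] at h2
    linarith [hBs b hb]
  have hX₂0 : ∀ x ∈ X₂, mink x x ≠ 0 := by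
    rintro _ ⟨⟨b, a⟩, ⟨hb, ha⟩, rfl⟩ h0
    simp only at hb ha h0
    have haV := truncCone_subset_Vplus hs ha
    have h1 := mink_nonneg_of_mem_Vplus (hBV hb) haV.1.le haV.2.le
    rw [mink_add_self] at h0
    linarith [haV.2, (hBV hb).2]
  set V : ℝ := volume.real Q
  have hV : 0 ≤ V := measureReal_nonneg
  set δ : ℝ := ε / (3 * (M * V + 1)) with hδdef
  have hMV : 0 ≤ M * V := mul_nonneg hM0 hV
  have hδ : 0 < δ := by positivity
  have hδV : M * δ * V ≤ ε / 3 := by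
    have : M * δ * V = ε / 3 * (M * V / (M * V + 1)) := by rw [hδdef]; field_simp
    rw [this]
    refine mul_le_of_le_one_right (by positivity) ?_
    rw [div_le_one (by positivity)]
    linarith
  have hsqrt : ∀ᶠ η : ℝ in 𝓝[>] 0, C * Real.sqrt η < ε / 3 := by
    have : Tendsto (fun η : ℝ => C * Real.sqrt η) (𝓝 0) (𝓝 0) :=
      (continuous_const.mul Real.continuous_sqrt).tendsto' _ _ (by simp)
    exact nhdsWithin_le_nhds (this.eventually_lt_const (by positivity))
  filter_upwards [hsqrt, self_mem_nhdsWithin,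
    nhdsWithin_le_nhds (eventually_norm_gradInvSq_sub_le hX₁ hX₁0 ν hδ),
    nhdsWithin_le_nhds (eventually_norm_gradInvSq_sub_le hX₂ hX₂0 ν hδ)] with η h1 hη h2 h3 β hβ
  have hη : 0 < η := hη
  have hkc : Continuous (pd ν (commKernel η)) :=
    ((contDiff_commKernel hη.ne').pd_smooth ν).continuous
  set Qβ : Set (Fin 4 → ℝ) := Icc (lowerCorner (L + 3)) (upperCorner (β 0) (L + 3)) with hQβ
  have hsub : Qβ ⊆ Q := by
    refine Icc_subset_Icc_right ?_
    intro i
    refine Fin.cases ?_ (fun j => ?_) i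
    · simpa [upperCorner] using hBL β hβ
    · simp [upperCorner]
  have hi₁ : IntegrableOn (fun x => pd ν (commKernel η) (β - x) * box u x) Q :=
    (Continuous.mul (by fun_prop) hbcont).continuousOn.integrableOn_compact hQc
  have hi₂ : IntegrableOn (fun x => pd ν (commKernel η) (β + x) * box u x) Q :=
    (Continuous.mul (by fun_prop) hbcont).continuousOn.integrableOn_compact hQc
  have hsplit : (∫ x in Q, box u x *
        (pd ν (commKernel η) (β - x) + pd ν (commKernel η) (β + x)))
      = (∫ x in Qβ, pd ν (commKernel η) (β - x) * box u x)
        + (∫ x in Q \ Qβ, pd ν (commKernel η) (β - x) * box u x)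
        + ∫ x in Q, pd ν (commKernel η) (β + x) * box u x := by
    rw [setIntegral_sdiff measurableSet_Icc hi₁ hsub, add_sub_cancel, ← integral_add hi₁ hi₂]
    refine integral_congr_ae (Eventually.of_forall fun x => ?_)
    simp only
    ring
  have hmem (x : Fin 4 → ℝ) (hx : x ∈ Q) (hb : box u x ≠ 0) :
      x ∈ truncCone s₁ L ∧ mink x x ≤ s₂ := by
    have hxt : x ∈ tsupport u := by
      by_contra h
      exact hb (box_eq_zero_of_notMem_tsupport h)
    have hxL : x 0 ≤ L := by simpa [upperCorner] using hx.2 0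
    refine ⟨⟨(hts hxt).1, (hts hxt).2.1, hxL⟩, ?_⟩
    by_contra! h
    exact hb (hwave x (truncCone_subset_Vplus hs (hts hxt)) hxL h)
  have hb₁ : ‖∫ x in Q \ Qβ, pd ν (commKernel η) (β - x) * box u x‖ ≤ ε / 3 := by
    have hle : volume.real (Q \ Qβ) ≤ V := measureReal_mono sdiff_subset hQc.measure_lt_top.ne
    refine (norm_setIntegral_le_of_norm_le_const (C := M * δ)
      ((measure_mono sdiff_subset).trans_lt hQc.measure_lt_top) fun x hx => ?_).trans
      ((mul_le_mul_of_nonneg_left hle (by positivity)).trans hδV)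
    by_cases hb : box u x = 0
    · rw [hb, mul_zero, norm_zero]; positivity
    obtain ⟨hxC, hxs⟩ := hmem x hx.1 hb
    have hx0 : β 0 ≤ x 0 := by
      by_contra! h
      refine hx.2 ⟨hx.1.1, fun i => ?_⟩
      refine Fin.cases ?_ (fun j => ?_) i
      · simpa [upperCorner] using h.le
      · simpa [upperCorner] using hx.1.2 j.succ
    have := h2 (β - x) ⟨(β, x), ⟨⟨hβ, hxC⟩, hxs, hx0⟩, rfl⟩
    rw [← pd_commKernel hη.ne'] at this
    rw [norm_mul, mul_comm]
    exact mul_le_mul (hM x) this.le (norm_nonneg _) hM0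
  have hb₂ : ‖∫ x in Q, pd ν (commKernel η) (β + x) * box u x‖ ≤ ε / 3 := by
    refine (norm_setIntegral_le_of_norm_le_const (C := M * δ) hQc.measure_lt_top
      fun x hx => ?_).trans hδV
    by_cases hb : box u x = 0
    · rw [hb, mul_zero, norm_zero]; positivity
    obtain ⟨hxC, hxs⟩ := hmem x hx hb
    have := h3 (β + x) ⟨(β, x), ⟨hβ, hxC⟩, rfl⟩
    rw [← pd_commKernel hη.ne'] at this
    rw [norm_mul, mul_comm]
    exact mul_le_mul (hM x) this.le (norm_nonneg _) hM0
  have hb₃ := (hC η hη β (hBV hβ).1.le).trans h1.le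
  rw [hsplit]
  calc _ = ‖((∫ x in Qβ, pd ν (commKernel η) (β - x) * box u x)
          - 4 * Complex.I * ((∫ s, profile s : ℝ) : ℂ) * pd ν u β)
        + (∫ x in Q \ Qβ, pd ν (commKernel η) (β - x) * box u x)
        + ∫ x in Q, pd ν (commKernel η) (β + x) * box u x‖ := by congr 1; ring
    _ ≤ ε / 3 + ε / 3 + ε / 3 := norm_add₃_le.trans (add_le_add (add_le_add hb₃ hb₁) hb₂)
    _ = ε := by ring

lemma KillsOdd.map_eq_zero {B : Set (Fin 4 → ℝ)} [CompactSpace B] (hBV : B ⊆ Vplus) {ν : Fin 4}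
    {T : C(B, ℂ) →L[ℂ] ℂ} (hT : KillsOdd ν T) {Ξ : (Fin 4 → ℝ) → ℂ}
    (hΞ : ContDiffOn ℝ (⊤ : ℕ∞) Ξ Vplus) (hwave : ∀ β ∈ Vplus, box Ξ β = 0) (G : C(B, ℂ))
    (hG : ∀ β : B, G β = pd ν Ξ β) : T G = 0 := by
  have hB : IsCompact B := isCompact_iff_compactSpace.2 ‹_›
  obtain ⟨s, hs, hBs⟩ : ∃ s : ℝ, 0 < s ∧ ∀ β ∈ B, s < mink β β := by
    rcases B.eq_empty_or_nonempty with rfl | hne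
    · exact ⟨1, one_pos, by simp⟩
    obtain ⟨b, hb, hmin⟩ := hB.exists_isMinOn hne continuous_mink_self.continuousOn
    exact ⟨mink b b / 2, half_pos (hBV hb).2, fun β hβ =>
      (half_lt_self (hBV hb).2).trans_le (hmin hβ)⟩
  obtain ⟨L, hL, hBL⟩ : ∃ L : ℝ, 0 ≤ L ∧ ∀ β ∈ B, β 0 ≤ L := by
    obtain ⟨L, hL⟩ := hB.bddAbove_image (f := fun x : Fin 4 → ℝ => x 0) (by fun_prop)
    exact ⟨max L 0, le_max_right _ _, fun β hβ => (hL ⟨β, hβ, rfl⟩).trans (le_max_left _ _)⟩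
  obtain ⟨u, hu, hts, huΞ⟩ := exists_cutoff hΞ (half_pos hs) (half_lt_self hs) (L + 1)
  rw [add_assoc, one_add_one_eq_two] at hts
  have hG' (β : B) : G β = pd ν u β := by
    rw [hG]
    exact ((huΞ β (hBV β.2) (hBs β β.2) (by linarith [hBL β β.2])).pd_eq ν).symm
  have hbu : ∀ x ∈ Vplus, x 0 ≤ L → s < mink x x → box u x = 0 := fun x hx hxL hxs => by
    rw [(huΞ x hx hxs (by linarith)).box_eq, hwave x hx]
  have hbcont : Continuous (box u) := hu.box_smooth.continuous
  set κ : ℂ := 4 * Complex.I * ((∫ s, profile s : ℝ) : ℂ) with hκ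
  have hκ0 : κ ≠ 0 := by
    have := integral_profile_pos.ne'
    simp [hκ, this]
  have hsmall (ε : ℝ) (hε : 0 < ε) : ‖T (κ • G)‖ ≤ ‖T‖ * ε := by
    obtain ⟨η, hη, hη0⟩ := ((eventually_norm_integral_even_sub_le hu (half_pos hs) hL hts hbu hB
      hBV hBs hBL ν hε).and self_mem_nhdsWithin).exists
    have hη0 : η ≠ 0 := (show 0 < η from hη0).ne'
    let Q : Set (Fin 4 → ℝ) := Icc (lowerCorner (L + 3)) (upperCorner L (L + 3))
    have hint : IntegrableOn (fun a => box u a • evenKernel B ν η a) Q :=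
      (hbcont.smul (continuous_evenKernel B ν hη0)).continuousOn.integrableOn_compact isCompact_Icc
    let Φ : C(B, ℂ) := ∫ a in Q, box u a • evenKernel B ν η a
    have hTΦ : T Φ = 0 := by
      rw [← T.integral_comp_comm hint]
      simp [map_evenKernel hBV hT hη0]
    have hΦ (β : B) : Φ β = ∫ x in Q, box u x *
        (pd ν (commKernel η) (β - x) + pd ν (commKernel η) (β + x)) := by
      have h := (ContinuousMap.evalCLM ℂ β).integral_comp_comm hint
      refine h.symm.trans ?_
      simp [evenKernel_apply ν hη0]
    have hn : ‖Φ - κ • G‖ ≤ ε := by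
      rw [ContinuousMap.norm_le _ hε.le]
      intro β
      rw [ContinuousMap.sub_apply, ContinuousMap.smul_apply, hΦ, hG', smul_eq_mul]
      exact hη β β.2
    calc ‖T (κ • G)‖ = ‖T (Φ - κ • G)‖ := by rw [map_sub, hTΦ, zero_sub, norm_neg]
      _ ≤ ‖T‖ * ‖Φ - κ • G‖ := T.le_opNorm _
      _ ≤ ‖T‖ * ε := by gcongr
  have hz : ‖T (κ • G)‖ ≤ 0 := by
    have ht : Tendsto (fun ε : ℝ => ‖T‖ * ε) (𝓝[>] 0) (𝓝 0) :=
      ((continuous_const.mul continuous_id).tendsto' _ _ (by simp)).mono_left nhdsWithin_le_nhds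
    refine ge_of_tendsto ht ?_
    filter_upwards [self_mem_nhdsWithin] with ε hε
    exact hsmall ε hε
  rw [map_smul, norm_le_zero_iff, smul_eq_mul] at hz
  exact (mul_eq_zero.1 hz).resolve_left hκ0

/-- A vector annihilated by every continuous functional that vanishes on `S` lies in the closed
span of `S`. -/
lemma mem_topologicalClosure_span {E : Type*} [NormedAddCommGroup E] [NormedSpace ℂ E]
    {S : Set E} {x : E} (h : ∀ T : E →L[ℂ] ℂ, (∀ y ∈ S, T y = 0) → T x = 0) :
    x ∈ (Submodule.span ℂ S).topologicalClosure := by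
  by_contra hx
  set p := (Submodule.span ℂ S).topologicalClosure with hp
  obtain ⟨T, r, hlt, hr⟩ := RCLike.geometric_hahn_banach_closed_point (𝕜 := ℂ)
    (s := (p : Set E)) (p.restrictScalars ℝ).convex
    (Submodule.isClosed_topologicalClosure _) hx
  have hr0 : 0 < r := by simpa using hlt 0 p.zero_mem
  have hker (y : E) (hy : y ∈ p) : T y = 0 := by
    by_contra hTy
    have := hlt (((r : ℂ) / T y) • y) (p.smul_mem _ hy)
    rw [map_smul, smul_eq_mul, div_mul_cancel₀ _ hTy] at this
    simp at this
  have hx0 := h T fun y hy => hker y (Submodule.le_topologicalClosure _ (Submodule.subset_span hy))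
  rw [hx0] at hr
  simp at hr
  linarith

end

/-- Second half of Lemma 3.1: for each fixed ν, the partial derivative ∂_ν Ξ
of any smooth solution Ξ of the wave equation on V₊ can be approximated,
uniformly on any compact B ⊆ V₊, by linear combinations of the functions
β ↦ ∂_ν ∂_{μ₁}⋯∂_{μ_m} (β·β)⁻¹ with m odd (the thermal functions of the
balanced derivatives of even total order of the Wick square). -/
theorem odd_balanced_thermal_functions_approximate_derivatives
    (Ξ : (Fin 4 → ℝ) → ℂ) (hΞ : ContDiffOn ℝ (⊤ : ℕ∞) Ξ Vplus)
    (hwave : ∀ β ∈ Vplus, box Ξ β = 0)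
    (B : Set (Fin 4 → ℝ)) (hB : IsCompact B) (hBV : B ⊆ Vplus)
    (ε : ℝ) (hε : 0 < ε) (ν : Fin 4) :
    ∃ (N : ℕ) (μ : Fin N → List (Fin 4)) (c : Fin N → ℂ),
      (∀ j, Odd (μ j).length) ∧
      (⨆ β : B, ‖pd ν Ξ (β : Fin 4 → ℝ)
        - ∑ j, c j *
            ((pdIter (ν :: μ j) (fun β' => (mink β' β')⁻¹) (β : Fin 4 → ℝ) : ℝ) : ℂ)‖)
        < ε := by
  have : CompactSpace B := isCompact_iff_compactSpace.1 hB
  let G : C(B, ℂ) := ⟨fun β => pd ν Ξ β, continuousOn_iff_continuous_domRestrict.1 fun β hβ =>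
    ((hΞ.contDiffAt (isOpen_Vplus.mem_nhds (hBV hβ))).pd_smooth
      ν).continuousAt.continuousWithinAt⟩
  let S : Set C(B, ℂ) := {φ | ∃ μ : List (Fin 4), Odd μ.length ∧
    ∀ β : B, φ β = ((pdIter (ν :: μ) (fun y => (mink y y)⁻¹) β : ℝ) : ℂ)}
  have hmem : G ∈ (Submodule.span ℂ S).topologicalClosure :=
    mem_topologicalClosure_span fun T hT =>
      KillsOdd.map_eq_zero hBV (T := T) (fun φ hφ => hT φ hφ) hΞ hwave G fun _ => rfl
  obtain ⟨g, hg, hGg⟩ := Metric.mem_closure_iff.1 hmem (ε / 2) (half_pos hε)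
  obtain ⟨N, c, φ, rfl⟩ := Submodule.mem_span_set'.1 hg
  choose μ hμ hφ using fun j => (φ j).2
  refine ⟨N, μ, c, hμ, lt_of_le_of_lt (Real.iSup_le (fun β => ?_) (half_pos hε).le)
    (half_lt_self hε)⟩
  have h : ‖(G - ∑ j, c j • (φ j : C(B, ℂ))) β‖ ≤ ε / 2 :=
    (ContinuousMap.norm_coe_le_norm _ β).trans (by rw [← dist_eq_norm]; exact hGg.le)
  rw [ContinuousMap.sub_apply, ContinuousMap.sum_apply] at h
  simp only [ContinuousMap.smul_apply, hφ, smul_eq_mul] at h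
  exact h
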